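/- arXiv:1209.4791 — 3 statements merged into one kernel-verified Lean document; each statement's English description precedes it below -/
import Mathlib

section
/- For each j ∈ {1, 2, 3} there exist a subgroup H of B₄(S²) and a homomorphism φ : Multiplicative ℤ →* MulAut (QuaternionGroup 2) such that the automorphism φ(ofAdd 1) has order j, H is isomorphic to the semidirect product (QuaternionGroup 2) ⋊_φ Multiplicative ℤ, and H is not maximal as a virtually cyclic subgroup of B₄(S²): H is properly contained in some virtually cyclic subgroup of B₄(S²). -/
/-- The defining relators of the sphere braid group `B₄(S²)` on generators
`σ₁ = of 0`, `σ₂ = of 1`, `σ₃ = of 2`: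
`σ₁σ₃ = σ₃σ₁`, `σ₁σ₂σ₁ = σ₂σ₁σ₂`, `σ₂σ₃σ₂ = σ₃σ₂σ₃`, `σ₁σ₂σ₃²σ₂σ₁ = 1`. -/
def sphereBraidRels : Set (FreeGroup (Fin 3)) :=
  { FreeGroup.of 0 * FreeGroup.of 2 * (FreeGroup.of 2 * FreeGroup.of 0)⁻¹,
    FreeGroup.of 0 * FreeGroup.of 1 * FreeGroup.of 0 *
      (FreeGroup.of 1 * FreeGroup.of 0 * FreeGroup.of 1)⁻¹,
    FreeGroup.of 1 * FreeGroup.of 2 * FreeGroup.of 1 *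
      (FreeGroup.of 2 * FreeGroup.of 1 * FreeGroup.of 2)⁻¹,
    FreeGroup.of 0 * FreeGroup.of 1 * FreeGroup.of 2 ^ 2 * FreeGroup.of 1 * FreeGroup.of 0 }

/-- The braid group `B₄(S²)` of the sphere on four strings, as a presented group. -/
abbrev B4S2 : Type := PresentedGroup sphereBraidRels

/-- The generator `σᵢ₊₁` of `B₄(S²)`. -/
def σ (i : Fin 3) : B4S2 := PresentedGroup.of i

/-- A group is *virtually cyclic* if it contains a cyclic subgroup of finite index. -/
def IsVirtuallyCyclic (G : Type*) [Group G] : Prop :=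
  ∃ H : Subgroup G, IsCyclic H ∧ H.FiniteIndex

/-- A subgroup `H` of `G` is *maximal as a virtually cyclic subgroup* if `H` is virtually
cyclic and is not properly contained in any virtually cyclic subgroup of `G`. -/
def IsMaximalVirtuallyCyclic {G : Type*} [Group G] (H : Subgroup G) : Prop :=
  IsVirtuallyCyclic H ∧ ∀ K : Subgroup G, IsVirtuallyCyclic K → H ≤ K → K = H

section Coxeter

variable {G : Type*} [Group G] {s t u : G}

theorem coxeter_mul_left (h₁ : s * u = u * s) (h₂ : s * t * s = t * s * t) :
    s * t * u * s = t * (s * t * u) :=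
  calc s * t * u * s = s * t * (u * s) := by simp only [mul_assoc]
    _ = s * t * s * u := by rw [← h₁]; simp only [mul_assoc]
    _ = t * (s * t * u) := by rw [h₂]; simp only [mul_assoc]

theorem coxeter_mul_middle (h₁ : s * u = u * s) (h₃ : t * u * t = u * t * u) :
    s * t * u * t = u * (s * t * u) :=
  calc s * t * u * t = s * (t * u * t) := by simp only [mul_assoc]
    _ = s * u * t * u := by rw [h₃]; simp only [mul_assoc]
    _ = u * (s * t * u) := by rw [h₁]; simp only [mul_assoc]

theorem coxeter_sq_mul_left (h₁ : s * u = u * s) (h₂ : s * t * s = t * s * t)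
    (h₃ : t * u * t = u * t * u) : (s * t * u) ^ 2 * s = u * (s * t * u) ^ 2 := by
  rw [pow_two, mul_assoc, coxeter_mul_left h₁ h₂, ← mul_assoc, coxeter_mul_middle h₁ h₃, mul_assoc]

theorem mul_coxeter_sq (h₁ : s * u = u * s) (h₂ : s * t * s = t * s * t)
    (h₃ : t * u * t = u * t * u) : s * (s * t * u) ^ 2 = (s * t * u) ^ 2 * u := by
  have h : (s * t * u) ^ 2 = s * t * s * (u * t * u) := by
    rw [pow_two, show s * t * u * (s * t * u) = s * t * (u * s) * t * u by
      simp only [mul_assoc], ← h₁]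
    simp only [mul_assoc]
  calc s * (s * t * u) ^ 2 = s * (t * s * t) * (t * u * t) := by
        rw [h, h₂, h₃]
        simp only [mul_assoc]
    _ = s * t * s * t * (t * u * t) := by simp only [mul_assoc]
    _ = s * t * s * t * (u * t * u) := by rw [h₃]
    _ = s * t * s * (t * u * t) * u := by simp only [mul_assoc]
    _ = (s * t * u) ^ 2 * u := by rw [h, h₃]

theorem coxeter_sq_mul_quotient (h₁ : s * u = u * s) (h₂ : s * t * s = t * s * t)
    (h₃ : t * u * t = u * t * u) :
    (s * t * u) ^ 2 * (s * u⁻¹) = (s * u⁻¹)⁻¹ * (s * t * u) ^ 2 := by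
  have h₄ := coxeter_sq_mul_left h₁ h₂ h₃
  have h₅ := mul_coxeter_sq h₁ h₂ h₃
  generalize (s * t * u) ^ 2 = x at h₄ h₅ ⊢
  rw [← mul_assoc, h₄, mul_inv_eq_iff_eq_mul, mul_inv_rev, inv_inv, mul_assoc, mul_assoc, ← h₅,
    inv_mul_cancel_left]

theorem mul_coxeter_sq_eq_quotient_mul (h₁ : s * u = u * s) (h₂ : s * t * s = t * s * t)
    (h₃ : t * u * t = u * t * u) :
    s * (s * t * u) ^ 2 = s * u⁻¹ * (s * t * u) ^ 2 * s := by
  rw [mul_assoc _ _ s, coxeter_sq_mul_left h₁ h₂ h₃, mul_assoc s u⁻¹, inv_mul_cancel_left]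

theorem coxeter_mul_quotient (h₁ : s * u = u * s) (h₄ : s * t * u ^ 2 * t * s = 1) :
    s * t * u * (s * u⁻¹) = (s * t * u) ^ 2 * (s * u⁻¹) * (s * t * u) := by
  have h₅ : t * s * (s * t * u ^ 2) = 1 := by
    rw [mul_eq_one_comm, ← mul_assoc, h₄]
  have h : s * u⁻¹ = s * t * s * (s * t * u) := by
    rw [mul_inv_eq_iff_eq_mul]
    calc s = s * (t * s * (s * t * u ^ 2)) := by rw [h₅, mul_one]
      _ = s * t * s * (s * t * u) * u := by simp only [mul_assoc, pow_two]
  have h' : (s * t * u) ^ 2 * (s * u⁻¹) = s * t * u * (s * t * s) := by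
    rw [← mul_assoc, mul_inv_eq_iff_eq_mul, pow_two]
    simp only [mul_assoc, h₁]
  rw [h', h]
  simp only [mul_assoc]

end Coxeter

section Quaternion

variable {G : Type*} [Group G] {x y d s t : G}

theorem mul_sq_eq_sq (hxy : x * y = y⁻¹ * x) : (x * y) ^ 2 = x ^ 2 := by
  have h : y * x * y = x := by rw [mul_assoc, hxy, mul_inv_cancel_left]
  rw [pow_two, pow_two, mul_assoc, ← mul_assoc y, h]

theorem sq_eq_sq_of_conj (hxy : x * y = y⁻¹ * x) (hd : d * y = x * y * d) (hdx : d ^ 2 = x) :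
    x ^ 2 = y ^ 2 := by
  have hc : d * x = x * d := by rw [← hdx, ← pow_succ', ← pow_succ]
  have h₁ : d * y ^ 2 = x ^ 2 * d := by
    rw [pow_two, ← mul_assoc, hd, mul_assoc, hd, ← mul_sq_eq_sq hxy, pow_two (x * y)]
    simp only [mul_assoc]
  have h₂ : d * x ^ 2 = x ^ 2 * d := by
    rw [pow_two, ← mul_assoc, hc, mul_assoc, hc, mul_assoc]
  exact mul_left_cancel (h₂.trans h₁.symm)

theorem pow_four_eq_one_of_conj (hxy : x * y = y⁻¹ * x) (hd : d * y = x * y * d)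
    (hdx : d ^ 2 = x) : y ^ 4 = 1 := by
  have hc : d * x = x * d := by rw [← hdx, ← pow_succ', ← pow_succ]
  have h₁ : x * y = x ^ 2 * y * x := by
    calc x * y = d * (d * y) := by rw [← hdx, pow_two, mul_assoc]
      _ = d * x * y * d := by rw [hd]; simp only [mul_assoc]
      _ = x * (d * y) * d := by rw [hc]; simp only [mul_assoc]
      _ = x ^ 2 * y * d ^ 2 := by rw [hd, pow_two, pow_two]; simp only [mul_assoc]
      _ = x ^ 2 * y * x := by rw [hdx]
  rw [hxy, mul_left_inj, sq_eq_sq_of_conj hxy hd hdx, inv_eq_iff_mul_eq_one] at h₁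
  rw [← h₁]
  simp only [pow_succ, pow_zero, one_mul, mul_assoc]

theorem mul_mul_eq_of_quaternion (hxy : x * y = y⁻¹ * x) (hsq : x ^ 2 = y ^ 2) :
    x * y * x = y := by
  rw [hxy, mul_assoc, ← pow_two, hsq, pow_two, inv_mul_cancel_left]

theorem mul_eq_of_conj_left (hxy : x * y = y⁻¹ * x) (hsq : x ^ 2 = y ^ 2)
    (hd : d * y = x * y * d) (hdx : d ^ 2 = x) (hds : d * s = t * d)
    (hs : s * x = y * x * s) : t * x = y * t := by
  have hc : d * x = x * d := by rw [← hdx, ← pow_succ', ← pow_succ]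
  rw [← mul_left_inj d]
  calc t * x * d = d * s * x := by rw [mul_assoc, ← hc, ← mul_assoc, hds]
    _ = d * y * x * s := by rw [mul_assoc, hs]; simp only [mul_assoc]
    _ = x * y * (d * x) * s := by rw [hd]; simp only [mul_assoc]
    _ = x * y * x * (d * s) := by rw [hc]; simp only [mul_assoc]
    _ = y * t * d := by rw [mul_mul_eq_of_quaternion hxy hsq, hds, mul_assoc]

theorem mul_eq_of_conj_right (hxy : x * y = y⁻¹ * x) (hsq : x ^ 2 = y ^ 2)
    (hd : d * y = x * y * d) (hds : d * s = t * d)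
    (htx : t * x = y * t) (hs : s * y = y * s) : t * y = x⁻¹ * t := by
  rw [← mul_left_inj d, ← mul_right_inj y]
  calc y * (t * y * d) = t * x * y * d := by rw [htx]; simp only [mul_assoc]
    _ = t * (d * y) := by rw [hd]; simp only [mul_assoc]
    _ = d * s * y := by rw [hds, mul_assoc]
    _ = d * y * s := by rw [mul_assoc, hs, mul_assoc]
    _ = x * y * (d * s) := by rw [hd, mul_assoc]
    _ = y * (x⁻¹ * t * d) := by
      rw [hds, ← mul_assoc, ← mul_assoc, ← mul_assoc, mul_left_inj, mul_left_inj,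
        eq_mul_inv_iff_mul_eq, mul_mul_eq_of_quaternion hxy hsq]

theorem mul_eq_mul_cube (hxy : x * y = y⁻¹ * x) (hy : y ^ 4 = 1) : y * x = x * y ^ 3 := by
  have h : SemiconjBy x y y⁻¹ := hxy
  rw [(h.pow_right 3).eq, inv_pow, mul_left_inj, eq_inv_iff_mul_eq_one, ← pow_succ', hy]

theorem inv_eq_mul_sq (hsq : x ^ 2 = y ^ 2) (hy : y ^ 4 = 1) : x⁻¹ = x * y ^ 2 := by
  rw [inv_eq_iff_mul_eq_one, ← mul_assoc, ← pow_two, hsq, ← pow_add, hy]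

end Quaternion

namespace QuaternionGroup

variable {G : Type*} [Group G]

/-- The homomorphism from the quaternion group of order eight determined by the images `y` of
`a 1` and `x` of `xa 0`. -/
def liftTwo (x y : G) (hy : y ^ 4 = 1) (hsq : x ^ 2 = y ^ 2) (hxy : x * y = y⁻¹ * x) :
    QuaternionGroup 2 →* G :=
  have hadd (i j : ZMod 4) : y ^ (i + j).val = y ^ i.val * y ^ j.val := by
    rw [ZMod.val_add, ← pow_eq_pow_mod _ hy, pow_add]
  have hsub (i j : ZMod 4) : y ^ (i - j).val = (y ^ j.val)⁻¹ * y ^ i.val := by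
    rw [eq_inv_mul_iff_mul_eq, ← hadd, add_sub_cancel]
  have hcomm (i : ZMod 4) : y ^ i.val * x = x * (y ^ i.val)⁻¹ := by
    have h : SemiconjBy x y y⁻¹ := hxy
    have h' := (h.pow_right i.val).inv_right
    rw [inv_pow, inv_inv] at h'
    exact h'.eq.symm
  { toFun
      | a i => y ^ i.val
      | xa i => x * y ^ i.val
    map_one' := pow_zero y
    map_mul' := by
      rintro (i | i) (j | j)
      · exact hadd i j
      · change x * y ^ (j - i).val = y ^ i.val * (x * y ^ j.val)
        rw [← mul_assoc, hcomm, hsub, mul_assoc]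
      · change x * y ^ (i + j).val = x * y ^ i.val * y ^ j.val
        rw [hadd, mul_assoc]
      · change y ^ (2 + j - i).val = x * y ^ i.val * (x * y ^ j.val)
        rw [mul_assoc, ← mul_assoc _ x, hcomm, hsub, hadd, ← mul_assoc, ← mul_assoc,
          ← mul_assoc x x, ← pow_two x, hsq]
        congr 1
        exact ((Commute.refl y).pow_pow _ _).inv_left.eq }

variable {x y : G} (hy : y ^ 4 = 1) (hsq : x ^ 2 = y ^ 2) (hxy : x * y = y⁻¹ * x)

theorem liftTwo_injective (hne : y ^ 2 ≠ 1) :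
    Function.Injective (liftTwo x y hy hsq hxy) := by
  rw [injective_iff_map_eq_one]
  intro q hq
  by_contra hq'
  have h : ∀ q : QuaternionGroup 2, q ≠ 1 → q = a 2 ∨ q ^ 2 = a 2 := by decide
  refine hne (?_ : liftTwo x y hy hsq hxy (a 2) = 1)
  obtain h | h := h q hq'
  · rw [← h, hq]
  · rw [← h, map_pow, hq, one_pow]

theorem hom_ext_two {f g : QuaternionGroup 2 →* G} (ha : f (a 1) = g (a 1))
    (hx : f (xa 0) = g (xa 0)) : f = g := by
  have h (i : ZMod 4) : a i = (a 1 : QuaternionGroup 2) ^ i.val := by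
    rw [a_one_pow, ZMod.natCast_zmod_val]
  ext (i | i)
  · rw [h, map_pow, map_pow, ha]
  · rw [show (xa i : QuaternionGroup 2) = xa 0 * a 1 ^ i.val by rw [← h, xa_mul_a, zero_add],
      map_mul, map_mul, map_pow, map_pow, ha, hx]

/-- The automorphism of the quaternion group of order eight fixing `a 1` and sending `xa 0` to
`xa (-1)`. -/
def shiftAut : MulAut (QuaternionGroup 2) where
  toFun
    | a i => a i
    | xa i => xa (i - 1)
  invFun
    | a i => a i
    | xa i => xa (i + 1)
  left_inv := by decide
  right_inv := by decide
  map_mul' := by decide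

/-- The automorphism of the quaternion group of order eight sending `xa 0` to `a 1` and `a 1` to
`xa 2`. -/
def swapAut : MulAut (QuaternionGroup 2) where
  toFun
    | a i => ![a 0, xa 2, a 2, xa 0] i
    | xa i => ![a 1, xa 1, a 3, xa 3] i
  invFun
    | a i => ![a 0, xa 0, a 2, xa 2] i
    | xa i => ![a 3, xa 1, a 1, xa 3] i
  left_inv := by decide
  right_inv := by decide
  map_mul' := by decide

theorem orderOf_shiftAut : orderOf shiftAut = 4 := by
  refine orderOf_eq_prime_pow (p := 2) (n := 1) (fun h => ?_) ?_
  · exact absurd (DFunLike.congr_fun h (xa 0)) (by decide)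
  · ext q
    revert q
    decide

theorem orderOf_shiftAut_mul_swapAut_inv : orderOf (shiftAut * swapAut⁻¹) = 3 := by
  refine orderOf_eq_prime ?_ fun h => ?_
  · ext q
    revert q
    decide
  · exact absurd (DFunLike.congr_fun h (xa 0)) (by decide)

end QuaternionGroup

section Extension

variable {Q G M : Type*} [Group Q] [Group G] [Group M]

/-- The pairs `(g, α)` such that conjugation by `g` extends `α` along `f`. -/
def intertwiningSubgroup (f : Q →* G) : Subgroup (G × MulAut Q) where
  carrier := {p | ∀ q, MulAut.conj p.1 (f q) = f (p.2 q)}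
  one_mem' q := by simp
  mul_mem' {p p'} hp hp' q := by
    rw [Prod.fst_mul, Prod.snd_mul, map_mul, MulAut.mul_apply, MulAut.mul_apply, hp', hp]
  inv_mem' {p} hp q := by
    rw [Prod.fst_inv, Prod.snd_inv, map_inv, MulAut.inv_apply, MulEquiv.symm_apply_eq, hp,
      MulAut.apply_inv_self]

open QuaternionGroup in
theorem mem_intertwiningSubgroup_of_generators {f : QuaternionGroup 2 →* G} {g : G}
    {α : MulAut (QuaternionGroup 2)} (ha : g * f (a 1) = f (α (a 1)) * g)
    (hx : g * f (xa 0) = f (α (xa 0)) * g) : (g, α) ∈ intertwiningSubgroup f := by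
  have h : (MulAut.conj g).toMonoidHom.comp f = f.comp α.toMonoidHom :=
    hom_ext_two (mul_inv_eq_of_eq_mul ha) (mul_inv_eq_of_eq_mul hx)
  exact fun q => DFunLike.congr_fun h q

/-- The homomorphism `Q ⋊ ℤ → G` given by `f` on `Q` and sending the generator of `ℤ` to `g`. -/
def semidirectZLift (f : Q →* G) (p : G × MulAut Q) (hp : p ∈ intertwiningSubgroup f) :
    Q ⋊[zpowersHom (MulAut Q) p.2] Multiplicative ℤ →* G :=
  SemidirectProduct.lift f (zpowersHom G p.1) fun n => by
    ext q
    exact ((intertwiningSubgroup f).zpow_mem hp n.toAdd q).symm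

variable {f : Q →* G} {p : G × MulAut Q} (hp : p ∈ intertwiningSubgroup f)

theorem semidirectZLift_apply (z : Q ⋊[zpowersHom (MulAut Q) p.2] Multiplicative ℤ) :
    semidirectZLift f p hp z = f z.left * p.1 ^ z.right.toAdd := rfl

theorem semidirectZLift_injective (hf : Function.Injective f) {ψ : G →* M}
    (hψ : ∀ q, ψ (f q) = 1) (hg : ∀ n : ℤ, ψ p.1 ^ n = 1 → n = 0) :
    Function.Injective (semidirectZLift f p hp) := by
  rw [injective_iff_map_eq_one]
  intro z hz
  rw [semidirectZLift_apply] at hz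
  have hr : z.right.toAdd = 0 := by
    apply hg
    have h := congrArg ψ hz
    rwa [map_mul, hψ, one_mul, map_one, map_zpow] at h
  rw [hr, zpow_zero, mul_one, map_eq_one_iff f hf] at hz
  exact SemidirectProduct.ext hz (toAdd_eq_zero.1 hr)

theorem isVirtuallyCyclic_range_semidirectZLift [Finite Q] :
    IsVirtuallyCyclic (semidirectZLift f p hp).range := by
  let F := (semidirectZLift f p hp).rangeRestrict
  let c : (semidirectZLift f p hp).range := F (SemidirectProduct.inr (Multiplicative.ofAdd 1))
  refine ⟨Subgroup.zpowers c, inferInstance, ?_⟩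
  have hsurj : Function.Surjective fun q : Q =>
      (F (SemidirectProduct.inl q) : _ ⧸ Subgroup.zpowers c) := by
    intro r
    obtain ⟨k, rfl⟩ := QuotientGroup.mk_surjective r
    obtain ⟨z, rfl⟩ := (semidirectZLift f p hp).rangeRestrict_surjective k
    refine ⟨z.left, QuotientGroup.eq.2 ⟨z.right.toAdd, ?_⟩⟩
    rw [eq_inv_mul_iff_mul_eq]
    change F _ * F _ ^ _ = F z
    rw [← map_zpow, ← map_zpow, ← map_mul, ← ofAdd_zsmul, zsmul_one]
    exact congrArg F (SemidirectProduct.inl_left_mul_inr_right z)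
  have := Finite.of_surjective _ hsurj
  exact Subgroup.finiteIndex_of_finite_quotient

theorem range_semidirectZLift_pow_lt {ψ : G →* M} (hψ : ∀ q, ψ (f q) = 1)
    (hg : ∀ n : ℤ, ψ p.1 ^ n = 1 → n = 0) {k : ℕ} (hk : 2 ≤ k) :
    (semidirectZLift f (p ^ k) (Subgroup.pow_mem _ hp k)).range <
      (semidirectZLift f p hp).range := by
  refine SetLike.lt_iff_le_and_exists.2 ⟨?_, p.1, ?_, ?_⟩
  · rintro _ ⟨z, rfl⟩
    refine ⟨⟨z.left, Multiplicative.ofAdd (k * z.right.toAdd)⟩, ?_⟩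
    rw [semidirectZLift_apply, semidirectZLift_apply, Prod.pow_fst, toAdd_ofAdd, zpow_mul,
      zpow_natCast]
  · refine ⟨SemidirectProduct.inr (Multiplicative.ofAdd 1), ?_⟩
    simp [semidirectZLift_apply]
  · rintro ⟨z, hz⟩
    rw [semidirectZLift_apply, Prod.pow_fst, ← zpow_natCast p.1, ← zpow_mul] at hz
    have h := congrArg ψ hz
    rw [map_mul, hψ, one_mul, map_zpow] at h
    have h' := hg (k * z.right.toAdd - 1) (by rw [zpow_sub_one, h, mul_inv_cancel])
    have h'' := Int.isUnit_iff.1 (IsUnit.of_mul_eq_one _ (sub_eq_zero.1 h'))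
    omega

theorem exists_nonmaximal_semidirectZ [Finite Q] (hp : p ∈ intertwiningSubgroup f)
    (hf : Function.Injective f) {ψ : G →* M} (hψ : ∀ q, ψ (f q) = 1) (hg : ∀ n : ℤ, ψ p.1 ^ n = 1 → n = 0) {k : ℕ} (hk : 2 ≤ k) :
    ∃ (H : Subgroup G) (φ : Multiplicative ℤ →* MulAut Q),
      φ (Multiplicative.ofAdd 1) = p.2 ^ k ∧ Nonempty (H ≃* Q ⋊[φ] Multiplicative ℤ) ∧
      ∃ K : Subgroup G, IsVirtuallyCyclic K ∧ H < K := by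
  have hinj : Function.Injective (semidirectZLift f (p ^ k) (Subgroup.pow_mem _ hp k)) := by
    refine semidirectZLift_injective _ hf hψ fun n hn => ?_
    rw [Prod.pow_fst, map_pow, ← zpow_natCast, ← zpow_mul] at hn
    have := hg _ hn
    have : (k : ℤ) ≠ 0 := by omega
    simp_all
  exact ⟨_, zpowersHom (MulAut Q) (p ^ k).2, by simp, ⟨(MonoidHom.ofInjective hinj).symm⟩, _,
    isVirtuallyCyclic_range_semidirectZLift hp, range_semidirectZLift_pow_lt hp hψ hg hk⟩

end Extension

theorem Equiv.Perm.zpow_eq_one_of_lt_apply {X : Type*} {e : Equiv.Perm X} {P : X → Prop}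
    {w : X → ℤ} (hP : ∀ v, P v → P (e v)) (hw : ∀ v, P v → w v < w (e v)) {v : X} (hv : P v)
    (n : ℤ) (hn : e ^ n = 1) : n = 0 := by
  have key (k : ℕ) : P ((e ^ k) v) ∧ w v + k ≤ w ((e ^ k) v) := by
    induction k with
    | zero => simpa using hv
    | succ k ih =>
      rw [pow_succ', Equiv.Perm.mul_apply]
      have := hw _ ih.1
      exact ⟨hP _ ih.1, by rw [Nat.cast_succ]; linarith [ih.2]⟩
  by_contra h
  have h' := (key n.natAbs).2
  rw [pow_natAbs_eq_one.2 hn, Equiv.Perm.one_apply] at h'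
  omega

namespace B4S2

theorem σ_zero_mul_σ_two : σ 0 * σ 2 = σ 2 * σ 0 :=
  mul_inv_eq_one.1 (PresentedGroup.one_of_mem (rels := sphereBraidRels) (Or.inl rfl))

theorem σ_zero_braid : σ 0 * σ 1 * σ 0 = σ 1 * σ 0 * σ 1 :=
  mul_inv_eq_one.1 (PresentedGroup.one_of_mem (rels := sphereBraidRels) (Or.inr (Or.inl rfl)))

theorem σ_one_braid : σ 1 * σ 2 * σ 1 = σ 2 * σ 1 * σ 2 :=
  mul_inv_eq_one.1
    (PresentedGroup.one_of_mem (rels := sphereBraidRels) (Or.inr (Or.inr (Or.inl rfl))))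

theorem σ_sphere : σ 0 * σ 1 * σ 2 ^ 2 * σ 1 * σ 0 = 1 :=
  PresentedGroup.one_of_mem (rels := sphereBraidRels) (Or.inr (Or.inr (Or.inr rfl)))

/-- The homomorphism out of `B₄(S²)` determined by elements satisfying its defining relations. -/
def lift {G : Type*} [Group G] (s t u : G) (h₁ : s * u = u * s) (h₂ : s * t * s = t * s * t)
    (h₃ : t * u * t = u * t * u) (h₄ : s * t * u ^ 2 * t * s = 1) : B4S2 →* G :=
  PresentedGroup.toGroup (f := ![s, t, u]) <| by
    rintro r (rfl | rfl | rfl | rfl)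
    · rw [map_mul, map_inv, mul_inv_eq_one]
      simpa using h₁
    · rw [map_mul, map_inv, mul_inv_eq_one]
      simpa using h₂
    · rw [map_mul, map_inv, mul_inv_eq_one]
      simpa using h₃
    · simpa using h₄

theorem lift_σ {G : Type*} [Group G] {s t u : G} (h₁ : s * u = u * s)
    (h₂ : s * t * s = t * s * t) (h₃ : t * u * t = u * t * u)
    (h₄ : s * t * u ^ 2 * t * s = 1) (i : Fin 3) :
    lift s t u h₁ h₂ h₃ h₄ (σ i) = ![s, t, u] i :=
  PresentedGroup.toGroup.of _

/-- A homomorphism to `GL₂(𝔽₇)` under which the full twist is not trivial. -/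
def toUnitsMatrix : B4S2 →* (Matrix (Fin 2) (Fin 2) (ZMod 7))ˣ :=
  lift ⟨!![0, 1; 3, 1], !![2, 5; 1, 0], by decide, by decide⟩
    ⟨!![0, 3; 1, 1], !![2, 1; 5, 0], by decide, by decide⟩
    ⟨!![1, 6; 4, 0], !![0, 2; 6, 2], by decide, by decide⟩
    (by decide) (by decide) (by decide) (by decide)

/-- The substitution `X ↦ X + Y` on binary quadratic forms. -/
def shearRight : Equiv.Perm (ℤ × ℤ × ℤ) where
  toFun v := (v.1, v.2.1 + 2 * v.1, v.1 + v.2.1 + v.2.2)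
  invFun v := (v.1, v.2.1 - 2 * v.1, v.1 - v.2.1 + v.2.2)
  left_inv v := by ext <;> dsimp only <;> ring
  right_inv v := by ext <;> dsimp only <;> ring

/-- The substitution `Y ↦ Y - X` on binary quadratic forms. -/
def shearLeft : Equiv.Perm (ℤ × ℤ × ℤ) where
  toFun v := (v.1 - v.2.1 + v.2.2, v.2.1 - 2 * v.2.2, v.2.2)
  invFun v := (v.1 + v.2.1 + v.2.2, v.2.1 + 2 * v.2.2, v.2.2)
  left_inv v := by ext <;> dsimp only <;> ring
  right_inv v := by ext <;> dsimp only <;> ring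

theorem shear_braid : shearRight * shearLeft * shearRight = shearLeft * shearRight * shearLeft := by
  ext v <;> simp only [Equiv.Perm.mul_apply] <;>
    dsimp only [shearRight, shearLeft, Equiv.coe_fn_mk] <;> ring

theorem shear_sphere :
    shearRight * shearLeft * shearRight ^ 2 * shearLeft * shearRight = 1 := by
  ext v <;> simp only [pow_two, Equiv.Perm.mul_apply, Equiv.Perm.one_apply] <;>
    dsimp only [shearRight, shearLeft, Equiv.coe_fn_mk] <;> ring

/-- The action of `B₄(S²)` on integral binary quadratic forms through `PSL₂(ℤ)`. -/
def toPermForms : B4S2 →* Equiv.Perm (ℤ × ℤ × ℤ) :=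
  lift shearRight shearLeft shearRight rfl shear_braid shear_braid.symm shear_sphere

theorem toPermForms_σ_zero : toPermForms (σ 0) = shearRight := lift_σ _ _ _ _ 0

theorem toPermForms_σ_one : toPermForms (σ 1) = shearLeft := lift_σ _ _ _ _ 1

theorem toPermForms_σ_two : toPermForms (σ 2) = shearRight := lift_σ _ _ _ _ 2

theorem coxeter_sq_mul_quotient :
    (σ 0 * σ 1 * σ 2) ^ 2 * (σ 0 * (σ 2)⁻¹) = (σ 0 * (σ 2)⁻¹)⁻¹ * (σ 0 * σ 1 * σ 2) ^ 2 :=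
  _root_.coxeter_sq_mul_quotient σ_zero_mul_σ_two σ_zero_braid σ_one_braid

theorem coxeter_mul_quotient : σ 0 * σ 1 * σ 2 * (σ 0 * (σ 2)⁻¹) =
    (σ 0 * σ 1 * σ 2) ^ 2 * (σ 0 * (σ 2)⁻¹) * (σ 0 * σ 1 * σ 2) :=
  _root_.coxeter_mul_quotient σ_zero_mul_σ_two σ_sphere

theorem quotient_pow_four : (σ 0 * (σ 2)⁻¹) ^ 4 = 1 :=
  pow_four_eq_one_of_conj coxeter_sq_mul_quotient coxeter_mul_quotient rfl

theorem coxeter_sq_sq : ((σ 0 * σ 1 * σ 2) ^ 2) ^ 2 = (σ 0 * (σ 2)⁻¹) ^ 2 :=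
  sq_eq_sq_of_conj coxeter_sq_mul_quotient coxeter_mul_quotient rfl

theorem quotient_sq_ne_one : (σ 0 * (σ 2)⁻¹) ^ 2 ≠ 1 := by
  intro h
  have h' := congrArg toUnitsMatrix h
  rw [map_pow, map_mul, map_inv, map_one, toUnitsMatrix, lift_σ, lift_σ] at h'
  exact absurd h' (by decide)

/-- The embedding of the quaternion group of order eight as a normal subgroup of `B₄(S²)`. -/
def ofQuaternion : QuaternionGroup 2 →* B4S2 :=
  QuaternionGroup.liftTwo ((σ 0 * σ 1 * σ 2) ^ 2) (σ 0 * (σ 2)⁻¹) quotient_pow_four coxeter_sq_sq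
    coxeter_sq_mul_quotient

theorem ofQuaternion_injective : Function.Injective ofQuaternion :=
  QuaternionGroup.liftTwo_injective _ _ _ quotient_sq_ne_one

theorem toPermForms_ofQuaternion (q : QuaternionGroup 2) : toPermForms (ofQuaternion q) = 1 := by
  suffices h : toPermForms.comp ofQuaternion = 1 from DFunLike.congr_fun h q
  refine QuaternionGroup.hom_ext_two ?_ ?_
  · change toPermForms ((σ 0 * (σ 2)⁻¹) ^ 1) = 1
    rw [pow_one, map_mul, map_inv, toPermForms_σ_zero, toPermForms_σ_two, mul_inv_cancel]
  · change toPermForms ((σ 0 * σ 1 * σ 2) ^ 2 * (σ 0 * (σ 2)⁻¹) ^ 0) = 1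
    rw [pow_zero, mul_one, map_pow, map_mul, map_mul, toPermForms_σ_zero, toPermForms_σ_one,
      toPermForms_σ_two]
    simpa only [pow_two, mul_assoc] using shear_sphere

theorem σ_zero_mul_quotient : σ 0 * (σ 0 * (σ 2)⁻¹) = σ 0 * (σ 2)⁻¹ * σ 0 :=
  ((Commute.refl (σ 0)).mul_right (Commute.inv_right σ_zero_mul_σ_two)).eq

theorem σ_zero_mul_coxeter_sq : σ 0 * (σ 0 * σ 1 * σ 2) ^ 2 =
    σ 0 * (σ 2)⁻¹ * (σ 0 * σ 1 * σ 2) ^ 2 * σ 0 :=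
  mul_coxeter_sq_eq_quotient_mul σ_zero_mul_σ_two σ_zero_braid σ_one_braid

theorem σ_one_mul_coxeter_sq : σ 1 * (σ 0 * σ 1 * σ 2) ^ 2 = σ 0 * (σ 2)⁻¹ * σ 1 :=
  mul_eq_of_conj_left coxeter_sq_mul_quotient coxeter_sq_sq coxeter_mul_quotient rfl
    (coxeter_mul_left σ_zero_mul_σ_two σ_zero_braid) σ_zero_mul_coxeter_sq

theorem σ_one_mul_quotient : σ 1 * (σ 0 * (σ 2)⁻¹) = ((σ 0 * σ 1 * σ 2) ^ 2)⁻¹ * σ 1 :=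
  mul_eq_of_conj_right coxeter_sq_mul_quotient coxeter_sq_sq coxeter_mul_quotient
    (coxeter_mul_left σ_zero_mul_σ_two σ_zero_braid) σ_one_mul_coxeter_sq σ_zero_mul_quotient

theorem σ_zero_mem_intertwiningSubgroup :
    (σ 0, QuaternionGroup.shiftAut) ∈ intertwiningSubgroup ofQuaternion := by
  refine mem_intertwiningSubgroup_of_generators ?_ ?_
  · change σ 0 * (σ 0 * (σ 2)⁻¹) ^ 1 = (σ 0 * (σ 2)⁻¹) ^ 1 * σ 0
    rw [pow_one, σ_zero_mul_quotient]
  · change σ 0 * ((σ 0 * σ 1 * σ 2) ^ 2 * (σ 0 * (σ 2)⁻¹) ^ 0) =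
      (σ 0 * σ 1 * σ 2) ^ 2 * (σ 0 * (σ 2)⁻¹) ^ 3 * σ 0
    rw [pow_zero, mul_one, ← mul_eq_mul_cube coxeter_sq_mul_quotient quotient_pow_four]
    exact σ_zero_mul_coxeter_sq

theorem σ_one_mem_intertwiningSubgroup :
    (σ 1, QuaternionGroup.swapAut) ∈ intertwiningSubgroup ofQuaternion := by
  refine mem_intertwiningSubgroup_of_generators ?_ ?_
  · change σ 1 * (σ 0 * (σ 2)⁻¹) ^ 1 =
      (σ 0 * σ 1 * σ 2) ^ 2 * (σ 0 * (σ 2)⁻¹) ^ 2 * σ 1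
    rw [pow_one, σ_one_mul_quotient, inv_eq_mul_sq coxeter_sq_sq quotient_pow_four]
  · change σ 1 * ((σ 0 * σ 1 * σ 2) ^ 2 * (σ 0 * (σ 2)⁻¹) ^ 0) = (σ 0 * (σ 2)⁻¹) ^ 1 * σ 1
    rw [pow_zero, mul_one, pow_one, σ_one_mul_coxeter_sq]

theorem toPermForms_σ_zero_zpow (n : ℤ) (hn : toPermForms (σ 0) ^ n = 1) : n = 0 := by
  rw [toPermForms_σ_zero] at hn
  refine Equiv.Perm.zpow_eq_one_of_lt_apply (P := fun v => 0 < v.1) (w := fun v => v.2.1)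
    (fun v hv => hv) (fun v hv => ?_) (v := (1, 0, 0)) one_pos n hn
  dsimp only [shearRight, Equiv.coe_fn_mk] at hv ⊢
  omega

theorem toPermForms_σ_zero_mul_inv_zpow (n : ℤ)
    (hn : toPermForms (σ 0 * (σ 1)⁻¹) ^ n = 1) : n = 0 := by
  rw [map_mul, map_inv, toPermForms_σ_zero, toPermForms_σ_one] at hn
  have happ (v : ℤ × ℤ × ℤ) :
      (shearRight * shearLeft⁻¹) v = shearRight (shearLeft.symm v) := rfl
  refine Equiv.Perm.zpow_eq_one_of_lt_apply (P := fun v => 0 < v.1 ∧ 0 < v.2.1 ∧ 0 < v.2.2)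
    (w := fun v => v.1) (fun v hv => ?_) (fun v hv => ?_) (v := (1, 1, 1)) (by decide) n hn
  all_goals
    rw [happ]
    dsimp only [shearRight, shearLeft, Equiv.coe_fn_mk, Equiv.coe_fn_symm_mk] at hv ⊢
    omega

end B4S2

/-- For each `j ∈ {1, 2, 3}`, there is a subgroup of `B₄(S²)` isomorphic
to a semidirect product `Q₈ ⋊ ℤ` in which the generator of `ℤ` acts by an automorphism of
order `j`, that is *not* maximal as a virtually cyclic subgroup of `B₄(S²)`. -/
theorem nonmaximal_Q8_semidirect_Z_subgroups (j : ℕ) (hj : j ∈ ({1, 2, 3} : Set ℕ)) :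
    ∃ (H : Subgroup B4S2) (φ : Multiplicative ℤ →* MulAut (QuaternionGroup 2)),
      orderOf (φ (Multiplicative.ofAdd 1)) = j ∧
      Nonempty (H ≃* SemidirectProduct (QuaternionGroup 2) (Multiplicative ℤ) φ) ∧
      ∃ K : Subgroup B4S2, IsVirtuallyCyclic K ∧ H < K := by
  simp only [Set.mem_insert_iff, Set.mem_singleton_iff] at hj
  have hσ (k : ℕ) (hk : 2 ≤ k) := exists_nonmaximal_semidirectZ
    B4S2.σ_zero_mem_intertwiningSubgroup B4S2.ofQuaternion_injective
    B4S2.toPermForms_ofQuaternion B4S2.toPermForms_σ_zero_zpow hk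
  have hστ (k : ℕ) (hk : 2 ≤ k) := exists_nonmaximal_semidirectZ
    (Subgroup.mul_mem _ B4S2.σ_zero_mem_intertwiningSubgroup
      (Subgroup.inv_mem _ B4S2.σ_one_mem_intertwiningSubgroup)) B4S2.ofQuaternion_injective
    B4S2.toPermForms_ofQuaternion B4S2.toPermForms_σ_zero_mul_inv_zpow hk
  obtain rfl | rfl | rfl := hj
  · obtain ⟨H, φ, hφ, h⟩ := hσ 4 (by norm_num)
    refine ⟨H, φ, ?_, h⟩
    rw [hφ, orderOf_pow, QuaternionGroup.orderOf_shiftAut]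
    rfl
  · obtain ⟨H, φ, hφ, h⟩ := hσ 2 le_rfl
    refine ⟨H, φ, ?_, h⟩
    rw [hφ, orderOf_pow, QuaternionGroup.orderOf_shiftAut]
    rfl
  · obtain ⟨H, φ, hφ, h⟩ := hστ 2 le_rfl
    refine ⟨H, φ, ?_, h⟩
    rw [hφ, Prod.snd_mul, Prod.snd_inv, orderOf_pow,
      QuaternionGroup.orderOf_shiftAut_mul_swapAut_inv]
    rfl
end

section
/- For each j ∈ {2, 3} there exist a subgroup M of B₄(S²) and a homomorphism φ : Multiplicative ℤ →* MulAut (QuaternionGroup 2) such that the automorphism φ(ofAdd 1) has order j, M is isomorphic to the semidirect product (QuaternionGroup 2) ⋊_φ Multiplicative ℤ, and M is maximal as a virtually cyclic subgroup of B₄(S²): M is virtually cyclic and every virtually cyclic subgroup of B₄(S²) containing M equals M. -/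
section SphereBraidIdentities

variable {G : Type*} [Group G] {a b c : G}

theorem inv_mul_mul_of_braid (h : a * b * a = b * a * b) : b⁻¹ * a * b = a * b * a⁻¹ := by
  calc b⁻¹ * a * b = b⁻¹ * (a * b * a) * a⁻¹ := by group
    _ = a * b * a⁻¹ := by rw [h]; group

variable (hac : a * c = c * a) (hab : a * b * a = b * a * b) (hbc : b * c * b = c * b * c)
  (h : a * b * c ^ 2 * b * a = 1)

include h in
theorem inv_mul_inv_mul_inv_of_sphere : a⁻¹ * b⁻¹ * c⁻¹ = a * b * c := by
  have h1 : c * b * a * (a * b * c) = 1 := by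
    calc c * b * a * (a * b * c) = (a * b * c)⁻¹ * (a * b * c ^ 2 * b * a) * (a * b * c) := by group
      _ = 1 := by rw [h]; group
  rw [eq_inv_of_mul_eq_one_right h1]
  group

include hac hab in
theorem rotation_mul_fst : a * b * c * a = b * (a * b * c) := by
  calc a * b * c * a = a * b * (c * a) := by group
    _ = (a * b * a) * c := by rw [← hac]; group
    _ = b * (a * b * c) := by rw [hab]; group

include hac hbc in
theorem rotation_mul_snd : a * b * c * b = c * (a * b * c) := by
  calc a * b * c * b = a * (b * c * b) := by group
    _ = (a * c) * b * c := by rw [hbc]; group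
    _ = c * (a * b * c) := by rw [hac]; group

include hac hab hbc h

theorem rotation_conj_trd : a * b * c * b⁻¹ * a⁻¹ = c * b * a * b⁻¹ * c⁻¹ := by
  have hca : a⁻¹ * c = c * a⁻¹ := Commute.inv_left hac
  calc a * b * c * b⁻¹ * a⁻¹ = (a * b * c) * c * (a * b * c)⁻¹ := by group
    _ = a⁻¹ * (b⁻¹ * c * b) * a := by rw [← inv_mul_inv_mul_inv_of_sphere h]; group
    _ = (a⁻¹ * c) * b * (a⁻¹ * c)⁻¹ := by rw [inv_mul_mul_of_braid hbc.symm]; group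
    _ = c * (a⁻¹ * b * a) * c⁻¹ := by rw [hca]; group
    _ = c * b * a * b⁻¹ * c⁻¹ := by rw [inv_mul_mul_of_braid hab.symm]; group

theorem conj_snd_eq_rotation_sq : b⁻¹ * (a * c⁻¹) * b = a * b * c * (a * b * c) := by
  have hca : a⁻¹ * c = c * a⁻¹ := Commute.inv_left hac
  calc b⁻¹ * (a * c⁻¹) * b = (b⁻¹ * a * b) * (b⁻¹ * c * b)⁻¹ := by group
    _ = a * b * (a⁻¹ * c) * b⁻¹ * c⁻¹ := by
      rw [inv_mul_mul_of_braid hab, inv_mul_mul_of_braid hbc.symm]; group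
    _ = (a * b * c) * (a⁻¹ * b⁻¹ * c⁻¹) := by rw [hca]; group
    _ = a * b * c * (a * b * c) := by rw [inv_mul_inv_mul_inv_of_sphere h]

theorem conj_snd_mul_fst : b⁻¹ * (a * c⁻¹) * b * a = c * (b⁻¹ * (a * c⁻¹) * b) := by
  have h1 := rotation_mul_fst hac hab
  have h2 := rotation_mul_snd hac hbc
  rw [conj_snd_eq_rotation_sq hac hab hbc h]
  generalize a * b * c = r at *
  rw [mul_assoc, h1, ← mul_assoc, h2, mul_assoc]

theorem conj_snd_mul_trd : b⁻¹ * (a * c⁻¹) * b * c = a * (b⁻¹ * (a * c⁻¹) * b) := by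
  have h4 := rotation_conj_trd hac hab hbc h
  rw [conj_snd_eq_rotation_sq hac hab hbc h]
  calc a * b * c * (a * b * c) * c
      = (a * b * c) * (a * b * c * b⁻¹ * a⁻¹) * (a * b * c) := by simp [mul_assoc]
    _ = (a * b * c ^ 2 * b * a) * b⁻¹ * c⁻¹ * (a * b * c) := by rw [h4]; simp [mul_assoc, pow_two]
    _ = a * (a⁻¹ * b⁻¹ * c⁻¹) * (a * b * c) := by rw [h]; simp [mul_assoc]
    _ = a * (a * b * c * (a * b * c)) := by rw [inv_mul_inv_mul_inv_of_sphere h]; simp [mul_assoc]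

theorem sq_eq_conj_snd_sq : (a * c⁻¹) ^ 2 = (b⁻¹ * (a * c⁻¹) * b) ^ 2 := by
  have h1 := rotation_mul_fst hac hab
  have h2 := rotation_mul_snd hac hbc
  have h3 := conj_snd_mul_trd hac hab hbc h
  have hy := conj_snd_eq_rotation_sq hac hab hbc h
  have key : b * (b⁻¹ * (a * c⁻¹) * b) ^ 2 = (b⁻¹ * (a * c⁻¹) * b) ^ 2 * b := by
    rw [hy] at h3 ⊢
    generalize a * b * c = r at *
    calc b * (r * r) ^ 2 = b * r * (r * r * r) := by simp [pow_two, mul_assoc]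
      _ = r * (a * (r * r)) * r := by rw [← h1]; simp [mul_assoc]
      _ = r * r * r * (c * r) := by rw [← h3]; simp [mul_assoc]
      _ = (r * r) ^ 2 * b := by rw [← h2]; simp [pow_two, mul_assoc]
  calc (a * c⁻¹) ^ 2 = b * (b⁻¹ * (a * c⁻¹) * b) ^ 2 * b⁻¹ := by simp [pow_two, mul_assoc]
    _ = (b⁻¹ * (a * c⁻¹) * b) ^ 2 := by rw [key, mul_inv_cancel_right]

theorem conj_snd_mul : b⁻¹ * (a * c⁻¹) * b * (a * c⁻¹) =
    (a * c⁻¹)⁻¹ * (b⁻¹ * (a * c⁻¹) * b) := by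
  have h1 := conj_snd_mul_fst hac hab hbc h
  have h2 := conj_snd_mul_trd hac hab hbc h
  generalize b⁻¹ * (a * c⁻¹) * b = y at *
  calc y * (a * c⁻¹) = c * a⁻¹ * (a * y) * c⁻¹ := by rw [← mul_assoc, h1]; simp [mul_assoc]
    _ = (a * c⁻¹)⁻¹ * y := by rw [← h2]; simp [mul_assoc]

theorem pow_four_eq_one : (a * c⁻¹) ^ 4 = 1 := by
  have h1 := conj_snd_mul hac hab hbc h
  have h2 := sq_eq_conj_snd_sq hac hab hbc h
  generalize b⁻¹ * (a * c⁻¹) * b = y at *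
  generalize a * c⁻¹ = x at *
  have h3 : y * x ^ 2 = x⁻¹ ^ 2 * y := by
    rw [pow_two x, ← mul_assoc, h1, mul_assoc, h1, pow_two, mul_assoc]
  have h4 : y * x ^ 2 * y⁻¹ = x ^ 2 := by rw [h2]; group
  calc x ^ 4 = x ^ 2 * x ^ 2 := by group
    _ = x ^ 2 * (y * x ^ 2 * y⁻¹) := by rw [h4]
    _ = 1 := by rw [h3]; group

theorem fst_mul_conj_snd : a * (b⁻¹ * (a * c⁻¹) * b) =
    b⁻¹ * (a * c⁻¹) * b * (a * c⁻¹)⁻¹ * a := by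
  rw [← conj_snd_mul_trd hac hab hbc h]
  group

theorem snd_mul : b * (a * c⁻¹) = (b⁻¹ * (a * c⁻¹) * b)⁻¹ * b := by
  have h2 := rotation_mul_snd hac hbc
  have h3 := conj_snd_mul_trd hac hab hbc h
  have h4 := conj_snd_mul_fst hac hab hbc h
  have h5 := sq_eq_conj_snd_sq hac hab hbc h
  have hy := conj_snd_eq_rotation_sq hac hab hbc h
  have h7 : (a * b * c) * (a * c⁻¹) * (a * b * c)⁻¹ =
      (a * c⁻¹)⁻¹ * (b⁻¹ * (a * c⁻¹) * b) := by
    calc (a * b * c) * (a * c⁻¹) * (a * b * c)⁻¹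
        = (a * b * c * b) * (b⁻¹ * (a * c⁻¹) * b) * (a * b * c * b)⁻¹ := by group
      _ = c * (b⁻¹ * (a * c⁻¹) * b) * c⁻¹ := by rw [h2, hy]; simp [mul_assoc]
      _ = c * a⁻¹ * (a * (b⁻¹ * (a * c⁻¹) * b)) * c⁻¹ := by group
      _ = (a * c⁻¹)⁻¹ * (b⁻¹ * (a * c⁻¹) * b) := by rw [← h3]; group
  have hca' : a⁻¹ * (c * (b⁻¹ * (a * (c⁻¹ * (b * b))))) =
      c * (a⁻¹ * (b⁻¹ * (a * (c⁻¹ * (b * b))))) := by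
    rw [← mul_assoc, Commute.inv_left hac, mul_assoc]
  have h8 : (a * b * c) * (a * c⁻¹) * (a * b * c)⁻¹ = a * (b * (a * c⁻¹) * b⁻¹) * a⁻¹ := by
    calc (a * b * c) * (a * c⁻¹) * (a * b * c)⁻¹
        = a * b * (c * a) * c⁻¹ * c⁻¹ * b⁻¹ * a⁻¹ := by simp [mul_assoc]
      _ = a * (b * (a * c⁻¹) * b⁻¹) * a⁻¹ := by rw [← hac]; simp [mul_assoc]
  have h9 : a⁻¹ * (a * c⁻¹)⁻¹ = (a * c⁻¹)⁻¹ * a⁻¹ := by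
    rw [← mul_inv_rev, ← mul_inv_rev, inv_inj]
    calc a * c⁻¹ * a = a * c⁻¹ * (a * c) * c⁻¹ := by simp [mul_assoc]
      _ = a * (a * c⁻¹) := by rw [hac]; simp [mul_assoc]
  calc b * (a * c⁻¹) = a⁻¹ * (a * (b * (a * c⁻¹) * b⁻¹) * a⁻¹) * a * b := by simp [mul_assoc]
    _ = a⁻¹ * (a * c⁻¹)⁻¹ * (b⁻¹ * (a * c⁻¹) * b * a) * b := by rw [← h8, h7]; simp [mul_assoc]
    _ = ((a * c⁻¹) ^ 2)⁻¹ * (b⁻¹ * (a * c⁻¹) * b) * b := by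
      rw [h9, h4]; simp [pow_two, mul_assoc, hca']
    _ = (b⁻¹ * (a * c⁻¹) * b)⁻¹ * b := by rw [h5]; simp [pow_two, mul_assoc]

end SphereBraidIdentities

section QuaternionGroup

open QuaternionGroup

variable {G : Type*} [Group G]

theorem pow_zmod_val_add {n : ℕ} [NeZero n] {x : G} (hx : x ^ n = 1) (i j : ZMod n) :
    x ^ (i + j).val = x ^ i.val * x ^ j.val := by
  rw [ZMod.val_add, ← pow_add, ← pow_eq_pow_mod _ hx]

/-- The homomorphism from `Q₈` given by two elements satisfying the quaternion relations. -/
def quaternionHom (x y : G) (hx : x ^ 4 = 1) (hxy : x ^ 2 = y ^ 2) (hyx : y * x = x⁻¹ * y) :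
    QuaternionGroup 2 →* G :=
  MonoidHom.mk' (fun
    | a i => x ^ i.val
    | xa i => y * x ^ i.val) <| by
    have hadd : ∀ i j : ZMod (2 * 2), x ^ (i + j).val = x ^ i.val * x ^ j.val :=
      pow_zmod_val_add (n := 2 * 2) hx
    have hsub (i j : ZMod (2 * 2)) : x ^ (j - i).val = (x ^ i.val)⁻¹ * x ^ j.val := by
      rw [eq_inv_mul_iff_mul_eq, ← hadd, add_sub_cancel]
    have hcomm (n : ℕ) : x ^ n * y = y * (x ^ n)⁻¹ := by
      have h : SemiconjBy y x x⁻¹ := hyx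
      simpa [SemiconjBy] using (h.inv_right.pow_right n).symm
    rintro (i | i) (j | j)
    · exact hadd i j
    · change y * x ^ (j - i).val = x ^ i.val * (y * x ^ j.val)
      rw [hsub, ← mul_assoc _ y, hcomm, mul_assoc]
    · change y * x ^ (i + j).val = y * x ^ i.val * x ^ j.val
      rw [hadd, mul_assoc]
    · change x ^ (2 + j - i).val = y * x ^ i.val * (y * x ^ j.val)
      have h2 : x ^ (2 : ZMod (2 * 2)).val = y * y := hxy.trans (pow_two y)
      rw [add_sub_assoc, hadd, hsub, h2]
      simp only [mul_assoc, ← mul_assoc _ y (x ^ j.val), hcomm]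

theorem quaternionHom_a_one {x y : G} (hx : x ^ 4 = 1) (hxy : x ^ 2 = y ^ 2)
    (hyx : y * x = x⁻¹ * y) : quaternionHom x y hx hxy hyx (a 1) = x :=
  pow_one x

theorem quaternionHom_xa_zero {x y : G} (hx : x ^ 4 = 1) (hxy : x ^ 2 = y ^ 2)
    (hyx : y * x = x⁻¹ * y) : quaternionHom x y hx hxy hyx (xa 0) = y :=
  congrArg (y * ·) (pow_zero x) |>.trans (mul_one y)

theorem quaternionGroup_two_closure :
    Subgroup.closure {a 1, xa 0} = (⊤ : Subgroup (QuaternionGroup 2)) := by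
  have ha : a 1 ∈ Subgroup.closure {a 1, (xa 0 : QuaternionGroup 2)} :=
    Subgroup.subset_closure (by simp)
  have hxa : xa 0 ∈ Subgroup.closure {a 1, (xa 0 : QuaternionGroup 2)} :=
    Subgroup.subset_closure (by simp)
  have hpow (i : ZMod (2 * 2)) : a i ∈ Subgroup.closure {a 1, (xa 0 : QuaternionGroup 2)} := by
    have := pow_mem ha i.val
    rwa [a_one_pow, ZMod.natCast_zmod_val] at this
  rw [eq_top_iff]
  rintro (i | i) -
  · exact hpow i
  · simpa using mul_mem hxa (hpow i)

theorem quaternionHom_injective {x y : G} (hx : x ^ 4 = 1) (hxy : x ^ 2 = y ^ 2)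
    (hyx : y * x = x⁻¹ * y) (h : x ^ 2 ≠ 1) :
    Function.Injective (quaternionHom x y hx hxy hyx) := by
  have h2 : quaternionHom x y hx hxy hyx (a 2) = x ^ 2 := rfl
  rw [injective_iff_map_eq_one]
  intro g hg
  by_contra hne
  have key : ∀ g : QuaternionGroup 2, g ≠ 1 → g = a 2 ∨ g ^ 2 = a 2 := by decide
  rcases key g hne with rfl | hg2
  · exact h (h2.symm.trans hg)
  · rw [← h2, ← hg2, map_pow, hg, one_pow] at h
    exact h rfl

theorem range_quaternionHom {x y : G} (hx : x ^ 4 = 1) (hxy : x ^ 2 = y ^ 2)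
    (hyx : y * x = x⁻¹ * y) :
    (quaternionHom x y hx hxy hyx).range = Subgroup.closure {x, y} := by
  rw [MonoidHom.range_eq_map, ← quaternionGroup_two_closure, MonoidHom.map_closure,
    Set.image_pair, quaternionHom_a_one, quaternionHom_xa_zero]

/-- The order two automorphism of `Q₈` with `x ↦ x⁻¹` and `y ↦ yx⁻¹`, where `x = a 1` and
`y = xa 0`. -/
def orderTwoAut : MulAut (QuaternionGroup 2) where
  toFun
    | a i => a (-i)
    | xa i => xa (-1 - i)
  invFun
    | a i => a (-i)
    | xa i => xa (-1 - i)
  left_inv := by decide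
  right_inv := by decide
  map_mul' := by decide

/-- The order three automorphism of `Q₈` with `x ↦ yx` and `y ↦ x⁻¹`, where `x = a 1` and
`y = xa 0`. -/
def orderThreeAut : MulAut (QuaternionGroup 2) :=
  let f : QuaternionGroup 2 → QuaternionGroup 2
    | a i => if Even i.val then a i else xa i
    | xa i => if Even i.val then a (i - 1) else xa (i + 1)
  { toFun := f
    invFun := f ∘ f
    left_inv := by decide
    right_inv := by decide
    map_mul' := by decide }

theorem orderOf_orderTwoAut : orderOf orderTwoAut = 2 := by
  refine orderOf_eq_prime (MulEquiv.ext ?_) fun h => ?_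
  · decide
  · have := DFunLike.congr_fun h (a 1)
    revert this
    decide

theorem orderOf_orderThreeAut : orderOf orderThreeAut = 3 := by
  refine orderOf_eq_prime (MulEquiv.ext ?_) fun h => ?_
  · decide
  · have := DFunLike.congr_fun h (a 1)
    revert this
    decide

/-- A homomorphism from `Q₈` intertwines an automorphism with conjugation as soon as it does so
on the two standard generators. -/
theorem map_mulAut_eq_conj {ι : QuaternionGroup 2 →* G} {θ : MulAut (QuaternionGroup 2)} {t : G}
    (ha : ι (θ (a 1)) = t * ι (a 1) * t⁻¹) (hxa : ι (θ (xa 0)) = t * ι (xa 0) * t⁻¹)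
    (g : QuaternionGroup 2) : ι (θ g) = t * ι g * t⁻¹ := by
  have : ι.comp θ.toMonoidHom = (MulAut.conj t).toMonoidHom.comp ι := by
    refine MonoidHom.eq_of_eqOn_dense quaternionGroup_two_closure ?_
    rintro _ (rfl | rfl)
    exacts [ha, hxa]
  exact DFunLike.congr_fun this g

end QuaternionGroup

theorem IsVirtuallyCyclic.exists_conj_zpow_eq {G : Type*} [Group G] (hG : IsVirtuallyCyclic G)
    {t : G} (ht : ∀ n : ℤ, t ^ n = 1 → n = 0) (k : G) :
    ∃ p q : ℤ, p ≠ 0 ∧ q ≠ 0 ∧ k * t ^ p * k⁻¹ = t ^ q := by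
  obtain ⟨H, hc, hH⟩ := hG
  obtain ⟨h, rfl⟩ := H.isCyclic_iff_exists_zpowers_eq_top.mp hc
  have hu (n : ℤ) (hn : (k * t * k⁻¹) ^ n = 1) : n = 0 := by
    rw [conj_zpow, conj_eq_one_iff] at hn
    exact ht n hn
  obtain ⟨n, hn, -, i, hi⟩ := Subgroup.exists_pow_mem_of_index_ne_zero hH.index_ne_zero t
  obtain ⟨m, hm, -, l, hl⟩ :=
    Subgroup.exists_pow_mem_of_index_ne_zero hH.index_ne_zero (k * t * k⁻¹)
  dsimp only at hi hl
  have hi0 : i ≠ 0 := by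
    rintro rfl
    have := ht n (by rw [zpow_natCast, ← hi, zpow_zero])
    omega
  have hl0 : l ≠ 0 := by
    rintro rfl
    have := hu m (by rw [zpow_natCast, ← hl, zpow_zero])
    omega
  refine ⟨m * i, n * l, by positivity, by positivity, ?_⟩
  rw [← conj_zpow, zpow_mul, zpow_natCast, ← hl, zpow_mul, zpow_natCast, ← hi, ← zpow_mul,
    ← zpow_mul, mul_comm]

section SemidirectProduct

variable {N G : Type*} [Group N] [Group G] {ι : N →* G} {θ : MulAut N} {t : G}

theorem map_zpow_mulAut_eq_conj (hθ : ∀ n, ι (θ n) = t * ι n * t⁻¹) (k : ℤ) (n : N) :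
    ι ((θ ^ k) n) = t ^ k * ι n * (t ^ k)⁻¹ := by
  induction k generalizing n with
  | zero => simp
  | succ k ih => rw [zpow_add_one, MulAut.mul_apply, ih, hθ, zpow_add_one]; group
  | pred k ih =>
    have h : ι (θ⁻¹ n) = t⁻¹ * ι n * t := by
      have := hθ (θ⁻¹ n)
      rw [MulAut.apply_inv_self] at this
      rw [this]
      group
    rw [zpow_sub_one, MulAut.mul_apply, ih, h, zpow_sub_one]; group

/-- An injective homomorphism `ι : N →* G` and an element `t` acting on the image of `ι` through
`θ`, no nontrivial power of which lies in this image, generate a copy of `N ⋊ ℤ`. -/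
theorem exists_subgroup_mulEquiv_semidirectProduct (hι : Function.Injective ι)
    (hθ : ∀ n, ι (θ n) = t * ι n * t⁻¹) (ht : ∀ k : ℤ, t ^ k ∈ ι.range → k = 0) :
    ∃ M : Subgroup G, (∀ g, g ∈ M ↔ ∃ n, ∃ k : ℤ, g = ι n * t ^ k) ∧
      Nonempty (M ≃* SemidirectProduct N (Multiplicative ℤ) (zpowersHom (MulAut N) θ)) := by
  let F : SemidirectProduct N (Multiplicative ℤ) (zpowersHom (MulAut N) θ) →* G :=
    SemidirectProduct.lift ι (zpowersHom G t) fun k => by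
      ext n
      exact map_zpow_mulAut_eq_conj hθ k.toAdd n
  have hF (x) : F x = ι x.left * t ^ x.right.toAdd := rfl
  have hinj : Function.Injective F := by
    rw [injective_iff_map_eq_one]
    rintro ⟨n, k⟩ h
    rw [hF] at h
    have hk : k.toAdd = 0 := ht _ ⟨n⁻¹, by rw [map_inv, inv_eq_of_mul_eq_one_right h]⟩
    rw [hk, zpow_zero, mul_one, map_eq_one_iff ι hι] at h
    exact SemidirectProduct.ext h (Multiplicative.toAdd.injective hk)
  refine ⟨F.range, fun g => ⟨?_, ?_⟩, ⟨(MonoidHom.ofInjective hinj).symm⟩⟩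
  · rintro ⟨x, rfl⟩
    exact ⟨_, _, hF x⟩
  · rintro ⟨n, k, rfl⟩
    exact ⟨⟨n, Multiplicative.ofAdd k⟩, hF _⟩

theorem isVirtuallyCyclic_of_mem_iff [Finite N] {M : Subgroup G}
    (hM : ∀ g, g ∈ M ↔ ∃ n, ∃ k : ℤ, g = ι n * t ^ k) : IsVirtuallyCyclic M := by
  have htM : t ∈ M := (hM t).mpr ⟨1, 1, by simp⟩
  have hιM (n : N) : ι n ∈ M := (hM _).mpr ⟨n, 0, by simp⟩
  refine ⟨Subgroup.zpowers ⟨t, htM⟩, inferInstance, ?_⟩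
  have hsurj : Function.Surjective fun n : N =>
      ((⟨ι n, hιM n⟩ : M) : M ⧸ Subgroup.zpowers (⟨t, htM⟩ : M)) := by
    intro q
    induction q using QuotientGroup.induction_on with | H g
    obtain ⟨n, k, hk⟩ := (hM g).mp g.2
    refine ⟨n, QuotientGroup.eq.mpr ⟨k, Subtype.ext ?_⟩⟩
    simp [hk]
  have := Finite.of_surjective _ hsurj
  exact Subgroup.finiteIndex_of_finite_quotient

end SemidirectProduct

section ModularGroup

open Matrix MatrixGroups

local notation "PSL₂ℤ" => Matrix.ProjectiveSpecialLinearGroup (Fin 2) ℤ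

theorem psl_mk_eq_mk_iff {A B : SL(2, ℤ)} : (A : PSL₂ℤ) = B ↔ A = B ∨ A = -B := by
  rw [QuotientGroup.eq, Matrix.SpecialLinearGroup.mem_center_iff]
  constructor
  · rintro ⟨r, hr, h⟩
    have hB : (B : Matrix (Fin 2) (Fin 2) ℤ) = A * scalar (Fin 2) r := by
      rw [h, ← Matrix.SpecialLinearGroup.coe_mul, mul_inv_cancel_left]
    rw [Fintype.card_fin, sq_eq_one_iff] at hr
    rcases hr with rfl | rfl
    · exact .inl (Subtype.ext (by simpa using hB.symm))
    · exact .inr (Subtype.ext (by simp [hB]))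
  · rintro (rfl | rfl)
    · exact ⟨1, by simp, by simp⟩
    · exact ⟨-1, by simp, by simp⟩

/-- The lower unitriangular matrix with entry `1`. -/
def lowerUnipotent : SL(2, ℤ) := ⟨!![1, 0; 1, 1], by simp⟩

theorem coe_lowerUnipotent :
    (lowerUnipotent : Matrix (Fin 2) (Fin 2) ℤ) = !![1, 0; 1, 1] := rfl

theorem exists_nonneg_of_mem_closure {G : Type*} [Group G] {s u : G} {f : G →* PSL₂ℤ}
    (hs : f s = ModularGroup.T) (hu : f u = (lowerUnipotent⁻¹ : SL(2, ℤ))) {w : G}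
    (hw : w ∈ Submonoid.closure {s, u⁻¹}) :
    ∃ m : SL(2, ℤ), f w = m ∧ (∀ i j, 0 ≤ m i j) ∧
      (w = 1 ∨ 3 ≤ m 0 0 + m 0 1 + m 1 0 + m 1 1) := by
  induction hw using Submonoid.closure_induction_right with
  | one => exact ⟨1, by simp, by simp [Fin.forall_fin_two], .inl rfl⟩
  | mul_right w _ v hv ih =>
    obtain ⟨m, hm, h0, -⟩ := ih
    have hdet := m.det_coe
    rw [det_fin_two] at hdet
    have h00 := h0 0 0
    have h01 := h0 0 1
    have h10 := h0 1 0
    have h11 := h0 1 1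
    have hpos : 0 < m 0 0 ∧ 0 < m 1 1 := by
      constructor <;> by_contra! hle <;> nlinarith
    rcases hv with rfl | rfl
    · refine ⟨m * ModularGroup.T, by rw [map_mul, hm, hs]; rfl, ?_, .inr ?_⟩
      · simp [Fin.forall_fin_two, ModularGroup.coe_T, mul_apply, Fin.sum_univ_two]
        omega
      · simp [ModularGroup.coe_T, mul_apply, Fin.sum_univ_two]
        omega
    · refine ⟨m * lowerUnipotent, by rw [map_mul, hm, map_inv, hu]; simp, ?_, .inr ?_⟩
      · simp [Fin.forall_fin_two, coe_lowerUnipotent, mul_apply, Fin.sum_univ_two]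
        omega
      · simp [coe_lowerUnipotent, mul_apply, Fin.sum_univ_two]
        omega

theorem eq_zero_of_nonneg_of_eq_one {m : SL(2, ℤ)} (h0 : ∀ i j, 0 ≤ m i j) {e i : ℕ}
    (he : e < 2) (hi : i < 3)
    (h : (((ModularGroup.T * lowerUnipotent⁻¹ * ModularGroup.T) ^ e * m *
      (ModularGroup.T * lowerUnipotent⁻¹) ^ i : SL(2, ℤ)) : PSL₂ℤ) = (1 : SL(2, ℤ))) :
    e = 0 ∧ i = 0 ∧ m 0 0 + m 0 1 + m 1 0 + m 1 1 = 2 := by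
  have hY : ((ModularGroup.T * lowerUnipotent⁻¹ : SL(2, ℤ)) : Matrix (Fin 2) (Fin 2) ℤ) =
      !![0, 1; -1, 1] := by
    simp [ModularGroup.coe_T, coe_lowerUnipotent, adjugate_fin_two]
  have hX : ((ModularGroup.T * lowerUnipotent⁻¹ * ModularGroup.T : SL(2, ℤ)) :
      Matrix (Fin 2) (Fin 2) ℤ) = !![0, 1; -1, 0] := by
    rw [Matrix.SpecialLinearGroup.coe_mul, hY]
    simp [ModularGroup.coe_T]
  rw [psl_mk_eq_mk_iff] at h
  generalize ModularGroup.T * lowerUnipotent⁻¹ * ModularGroup.T = X at *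
  generalize ModularGroup.T * lowerUnipotent⁻¹ = Y at *
  have h00 := h0 0 0
  have h01 := h0 0 1
  have h10 := h0 1 0
  have h11 := h0 1 1
  interval_cases e <;> interval_cases i <;>
    simp [Matrix.SpecialLinearGroup.ext_iff, Fin.forall_fin_two, mul_apply, Fin.sum_univ_two,
      pow_two, hX, hY, vecMul, dotProduct] at h ⊢ <;>
    omega

theorem exists_normal_form {G : Type*} [Group G] {x y : G}
    (hgen : Subgroup.closure {x, y} = ⊤) (hx : x ^ 2 = 1) (hy : y ^ 3 = 1) (g : G) :
    ∃ e < 2, ∃ w ∈ Submonoid.closure {y ^ 2 * x, y * x}, ∃ i < 3, g = x ^ e * w * y ^ i := by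
  have hlast {w : G} (hw : w ∈ Submonoid.closure {y ^ 2 * x, y * x}) : w = 1 ∨
      ∃ w' ∈ Submonoid.closure {y ^ 2 * x, y * x}, w = w' * (y ^ 2 * x) ∨ w = w' * (y * x) := by
    induction hw using Submonoid.closure_induction_right with
    | one => exact .inl rfl
    | mul_right w hw v hv _ =>
      rcases hv with rfl | rfl
      exacts [.inr ⟨w, hw, .inl rfl⟩, .inr ⟨w, hw, .inr rfl⟩]
  let NF (g : G) : Prop :=
    ∃ e < 2, ∃ w ∈ Submonoid.closure {y ^ 2 * x, y * x}, ∃ i < 3, g = x ^ e * w * y ^ i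
  have hNFy {g : G} (hg : NF g) : NF (g * y) := by
    obtain ⟨e, he, w, hw, i, hi, rfl⟩ := hg
    by_cases h2 : i = 2
    · subst h2
      refine ⟨e, he, w, hw, 0, by omega, ?_⟩
      rw [mul_assoc, ← pow_succ, hy, pow_zero]
    · exact ⟨e, he, w, hw, i + 1, by omega, by rw [pow_succ, mul_assoc]⟩
  have hNFx {g : G} (hg : NF g) : NF (g * x) := by
    obtain ⟨e, he, w, hw, i, hi, rfl⟩ := hg
    rw [pow_two] at hx
    interval_cases i
    · rcases hlast hw with rfl | ⟨w', hw', rfl | rfl⟩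
      · interval_cases e
        · exact ⟨1, by omega, 1, one_mem _, 0, by omega, by simp⟩
        · exact ⟨0, by omega, 1, one_mem _, 0, by omega, by simpa using hx⟩
      · exact ⟨e, he, w', hw', 2, by omega, by simp [mul_assoc, hx]⟩
      · exact ⟨e, he, w', hw', 1, by omega, by simp [mul_assoc, hx]⟩
    · exact ⟨e, he, w * (y * x), mul_mem hw (Submonoid.subset_closure (by simp)), 0, by omega,
        by simp [mul_assoc]⟩
    · exact ⟨e, he, w * (y ^ 2 * x), mul_mem hw (Submonoid.subset_closure (by simp)), 0,
        by omega, by simp [mul_assoc]⟩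
  have hmem : g ∈ Subgroup.closure {x, y} := by rw [hgen]; trivial
  change NF g
  induction hmem using Subgroup.closure_induction_right with
  | one => exact ⟨0, by omega, 1, one_mem _, 0, by omega, by simp⟩
  | mul_right g _ v hv ih =>
    rcases hv with rfl | rfl
    exacts [hNFx ih, hNFy ih]
  | mul_inv_cancel g _ v hv ih =>
    rcases hv with rfl | rfl
    · rw [inv_eq_of_mul_eq_one_right (pow_two v ▸ hx)]
      exact hNFx ih
    · rw [inv_eq_of_mul_eq_one_right (b := v * v) (by rw [← pow_two, ← pow_succ', hy]), ← mul_assoc]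
      exact hNFy (hNFy ih)

/-- The braid presentation of `PSL₂(ℤ)`, in the form of an injectivity criterion. -/
theorem injective_of_braid_relations {G : Type*} [Group G] {s u : G}
    (hgen : Subgroup.closure {s, u} = ⊤) (hbraid : s * u * s = u * s * u)
    (hsq : (s * u * s) ^ 2 = 1) {f : G →* PSL₂ℤ} (hs : f s = ModularGroup.T)
    (hu : f u = (lowerUnipotent⁻¹ : SL(2, ℤ))) : Function.Injective f := by
  rw [injective_iff_map_eq_one]
  intro g hg
  have hcube : (s * u) ^ 3 = 1 := by
    rw [← hsq]
    calc (s * u) ^ 3 = s * u * s * (u * s * u) := by simp [pow_succ, mul_assoc]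
      _ = (s * u * s) ^ 2 := by rw [← hbraid, pow_two]
  have hsxy : (s * u) ^ 2 * (s * u * s) = s := by
    rw [← mul_assoc, ← pow_succ, hcube, one_mul]
  have huxy : s * u * (s * u * s) = u⁻¹ := by
    rw [eq_inv_iff_mul_eq_one, ← hcube]
    simp [pow_succ, mul_assoc]
  have hgen' : Subgroup.closure {s * u * s, s * u} = ⊤ := by
    rw [eq_top_iff, ← hgen, Subgroup.closure_le]
    have hx : s * u * s ∈ Subgroup.closure {s * u * s, s * u} :=
      Subgroup.subset_closure (by simp)
    have hy : s * u ∈ Subgroup.closure {s * u * s, s * u} := Subgroup.subset_closure (by simp)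
    rintro v (rfl | rfl)
    · simpa only [inv_mul_cancel_left, SetLike.mem_coe] using mul_mem (inv_mem hy) hx
    · exact inv_mem_iff.mp (huxy ▸ mul_mem hy hx)
  obtain ⟨e, he, w, hw, i, hi, rfl⟩ := exists_normal_form hgen' hsq hcube g
  rw [hsxy, huxy] at hw
  obtain ⟨m, hm, h0, hsum⟩ := exists_nonneg_of_mem_closure hs hu hw
  simp only [map_mul, map_pow, hs, hu, hm] at hg
  obtain ⟨rfl, rfl, h2⟩ := eq_zero_of_nonneg_of_eq_one h0 he hi hg
  rcases hsum with rfl | h3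
  · simp
  · omega

end ModularGroup
section ConjugationOfPowers

open Matrix MatrixGroups

local notation "PSL₂ℤ" => Matrix.ProjectiveSpecialLinearGroup (Fin 2) ℤ

theorem psl_zpow_eq_one_iff {A : SL(2, ℤ)} {n : ℤ} :
    (A : PSL₂ℤ) ^ n = 1 ↔ A ^ n = 1 ∨ A ^ n = -1 :=
  psl_mk_eq_mk_iff (A := A ^ n) (B := 1)

theorem psl_mk_eq_zpow_iff {m A : SL(2, ℤ)} {n : ℤ} :
    (m : PSL₂ℤ) = A ^ n ↔ m = A ^ n ∨ m = -A ^ n :=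
  psl_mk_eq_mk_iff (B := A ^ n)

theorem psl_conj_zpow_eq_zpow_iff {m A : SL(2, ℤ)} {p q : ℤ} :
    (m : PSL₂ℤ) * A ^ p * (m : PSL₂ℤ)⁻¹ = A ^ q ↔
      m * A ^ p = A ^ q * m ∨ m * A ^ p = -(A ^ q * m) := by
  rw [mul_inv_eq_iff_eq_mul]
  exact psl_mk_eq_mk_iff (A := m * A ^ p) (B := A ^ q * m)

theorem psl_T_zpow_eq_one {n : ℤ} (h : (ModularGroup.T : PSL₂ℤ) ^ n = 1) : n = 0 := by
  rw [psl_zpow_eq_one_iff] at h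
  simpa [Matrix.SpecialLinearGroup.ext_iff, ModularGroup.coe_T_zpow, Fin.forall_fin_two] using h

theorem psl_eq_T_zpow_of_conj {g : PSL₂ℤ} {p q : ℤ} (hp : p ≠ 0)
    (h : g * (ModularGroup.T : PSL₂ℤ) ^ p * g⁻¹ = (ModularGroup.T : PSL₂ℤ) ^ q) :
    ∃ n : ℤ, g = (ModularGroup.T : PSL₂ℤ) ^ n := by
  obtain ⟨m, rfl⟩ := QuotientGroup.mk_surjective g
  have hdet := m.det_coe
  rw [det_fin_two] at hdet
  rw [psl_conj_zpow_eq_zpow_iff] at h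
  have hc : m 1 0 = 0 := by
    rcases h with h | h
    · have h11 := congrArg (fun A : SL(2, ℤ) => A 1 1) h
      simp [ModularGroup.coe_T_zpow, mul_apply, Fin.sum_univ_two, hp] at h11
      exact h11
    · have h10 := congrArg (fun A : SL(2, ℤ) => A 1 0) h
      simp [ModularGroup.coe_T_zpow, mul_apply, Fin.sum_univ_two, vecMul, dotProduct] at h10
      omega
  rw [hc, mul_zero, sub_zero] at hdet
  rcases Int.mul_eq_one_iff_eq_one_or_neg_one.mp hdet with ⟨ha, hd⟩ | ⟨ha, hd⟩
  · refine ⟨m 0 1, psl_mk_eq_zpow_iff.mpr (.inl ?_)⟩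
    simp [Matrix.SpecialLinearGroup.ext_iff, ModularGroup.coe_T_zpow, Fin.forall_fin_two, *]
  · refine ⟨-m 0 1, psl_mk_eq_zpow_iff.mpr (.inr ?_)⟩
    ext i j
    rw [Matrix.SpecialLinearGroup.coe_neg, ModularGroup.coe_T_zpow]
    fin_cases i <;> fin_cases j <;> simp [*]

/-- The hyperbolic matrix `T ^ 3 * lowerUnipotent`. -/
def hyperbolic : SL(2, ℤ) := ⟨!![4, 3; 1, 1], by simp⟩

theorem coe_hyperbolic : (hyperbolic : Matrix (Fin 2) (Fin 2) ℤ) = !![4, 3; 1, 1] := rfl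

theorem T_pow_three_mul_lowerUnipotent :
    ModularGroup.T ^ 3 * lowerUnipotent = hyperbolic := by
  ext i j
  have h3 := ModularGroup.coe_T_zpow 3
  norm_cast at h3
  rw [Matrix.SpecialLinearGroup.coe_mul, h3, coe_hyperbolic, coe_lowerUnipotent]
  simp

theorem commute_hyperbolic_iff {m : SL(2, ℤ)} :
    Commute m hyperbolic ↔ m 0 1 = 3 * m 1 0 ∧ m 0 0 = m 1 1 + 3 * m 1 0 := by
  simp [commute_iff_eq, Matrix.SpecialLinearGroup.ext_iff, coe_hyperbolic, Fin.forall_fin_two,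
    mul_apply, Fin.sum_univ_two]
  omega

theorem norm_form_of_commute_hyperbolic {m : SL(2, ℤ)} (h : Commute m hyperbolic) :
    m 1 1 ^ 2 + 3 * m 1 0 * m 1 1 - 3 * m 1 0 ^ 2 = 1 := by
  rw [commute_hyperbolic_iff] at h
  have hdet := m.det_coe
  rw [det_fin_two, h.1, h.2] at hdet
  linarith

theorem exists_eq_hyperbolic_pow {m : SL(2, ℤ)} (hm : Commute m hyperbolic) (n : ℕ)
    (h10 : m 1 0 = n) (h11 : 0 < m 1 1) : ∃ k : ℕ, m = hyperbolic ^ k := by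
  induction n using Nat.strong_induction_on generalizing m with
  | h n ih =>
    have hnorm := norm_form_of_commute_hyperbolic hm
    rcases Nat.eq_zero_or_pos n with rfl | hn
    · rw [commute_hyperbolic_iff] at hm
      have hd : m 1 1 = 1 := by rw [h10] at hnorm; push_cast at hnorm; nlinarith
      refine ⟨0, ?_⟩
      simp [Matrix.SpecialLinearGroup.ext_iff, Fin.forall_fin_two, hm, h10, hd]
    · have hn' : 0 < m 1 0 := by omega
      have hle : m 1 1 ≤ m 1 0 := by by_contra!; nlinarith
      have hlt : 3 * m 1 0 < 4 * m 1 1 := by by_contra!; nlinarith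
      have e10 : (m * hyperbolic⁻¹) 1 0 = m 1 0 - m 1 1 := by
        simp [coe_hyperbolic, mul_apply, Fin.sum_univ_two, adjugate_fin_two]
        ring
      have e11 : (m * hyperbolic⁻¹) 1 1 = 4 * m 1 1 - 3 * m 1 0 := by
        simp [coe_hyperbolic, mul_apply, Fin.sum_univ_two, adjugate_fin_two]
        ring
      obtain ⟨k, hk⟩ := ih (m 1 0 - m 1 1).toNat (by omega)
        (hm.mul_left (Commute.refl hyperbolic).inv_left) (by omega) (by omega)
      exact ⟨k + 1, by rw [pow_succ, ← hk, inv_mul_cancel_right]⟩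

theorem exists_eq_hyperbolic_zpow {m : SL(2, ℤ)} (hm : Commute m hyperbolic) :
    ∃ n : ℤ, m = hyperbolic ^ n ∨ m = -hyperbolic ^ n := by
  wlog h11 : 0 < m 1 1 generalizing m
  · have hne : m 1 1 ≠ 0 := by
      intro h0
      have := norm_form_of_commute_hyperbolic hm
      rw [h0] at this
      omega
    obtain ⟨n, hn⟩ := this (m := -m) hm.neg_left (by simp; omega)
    refine ⟨n, hn.symm.imp neg_inj.mp neg_eq_iff_eq_neg.mp⟩
  have hnorm := norm_form_of_commute_hyperbolic hm
  rcases le_total 0 (m 1 0) with h10 | h10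
  · obtain ⟨k, hk⟩ := exists_eq_hyperbolic_pow hm (m 1 0).toNat (by omega) h11
    exact ⟨k, .inl (by simpa using hk)⟩
  · have h00 := (commute_hyperbolic_iff.mp hm).2
    obtain ⟨k, hk⟩ := exists_eq_hyperbolic_pow (m := m⁻¹) hm.inv_left (-m 1 0).toNat
      (by simp [adjugate_fin_two, h10])
      (by simp [adjugate_fin_two]; rw [h00]; by_contra!; nlinarith)
    exact ⟨-k, .inl (by rw [_root_.zpow_neg, zpow_natCast, ← hk, inv_inv])⟩

theorem hyperbolic_pow_apply_pos {n : ℕ} (hn : n ≠ 0) (i j : Fin 2) :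
    0 < (hyperbolic ^ n) i j := by
  induction n, Nat.one_le_iff_ne_zero.mpr hn using Nat.le_induction generalizing i j with
  | base => fin_cases i <;> fin_cases j <;> simp [coe_hyperbolic]
  | succ n hn ih =>
    have h0 := ih (by omega) i 0
    have h1 := ih (by omega) i 1
    rw [pow_succ, Matrix.SpecialLinearGroup.coe_mul, mul_apply, Fin.sum_univ_two]
    generalize hyperbolic ^ n = B at h0 h1 ⊢
    fin_cases j <;> simp [coe_hyperbolic] <;> omega

theorem hyperbolic_zpow_apply_ne_zero {n : ℤ} (hn : n ≠ 0) : (hyperbolic ^ n) 1 0 ≠ 0 := by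
  obtain ⟨k, rfl | rfl⟩ := n.eq_nat_or_neg
  · rw [zpow_natCast]
    exact (hyperbolic_pow_apply_pos (by simpa using hn) 1 0).ne'
  · have := hyperbolic_pow_apply_pos (n := k) (by simpa using hn) 1 0
    rw [_root_.zpow_neg, zpow_natCast]
    generalize hyperbolic ^ k = B at this ⊢
    simpa [adjugate_fin_two] using this.ne'

theorem psl_hyperbolic_zpow_eq_one {n : ℤ} (h : (hyperbolic : PSL₂ℤ) ^ n = 1) : n = 0 := by
  by_contra hn
  apply hyperbolic_zpow_apply_ne_zero hn
  rcases psl_zpow_eq_one_iff.mp h with h | h <;> simp [h]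

theorem commute_hyperbolic_of_conj {m A B : SL(2, ℤ)} (hA : Commute A hyperbolic)
    (hB : Commute B hyperbolic) (hA0 : A 1 0 ≠ 0) (h : m * A = B * m) :
    Commute m hyperbolic := by
  have hnA := norm_form_of_commute_hyperbolic hA
  have hnB := norm_form_of_commute_hyperbolic hB
  rw [commute_hyperbolic_iff] at hA hB ⊢
  have hdet := m.det_coe
  rw [det_fin_two] at hdet
  have htr : A 0 0 + A 1 1 = B 0 0 + B 1 1 := by
    have : A = m⁻¹ * B * m := by rw [mul_assoc, ← h, inv_mul_cancel_left]
    have h2 := congrArg (fun A : SL(2, ℤ) => trace (A : Matrix (Fin 2) (Fin 2) ℤ)) this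
    simp only [Matrix.SpecialLinearGroup.coe_mul] at h2
    rw [trace_mul_cycle, ← Matrix.SpecialLinearGroup.coe_mul, mul_inv_cancel] at h2
    simpa [trace_fin_two] using h2
  have hsq : A 1 0 ^ 2 = B 1 0 ^ 2 := by
    rw [hA.2, hB.2] at htr
    have : (A 1 1 + 3 * A 1 0 + A 1 1) ^ 2 = (B 1 1 + 3 * B 1 0 + B 1 1) ^ 2 := by rw [htr]
    linarith
  simp [Matrix.SpecialLinearGroup.ext_iff, Fin.forall_fin_two, mul_apply, Fin.sum_univ_two] at h
  obtain ⟨⟨h1, -⟩, h3, -⟩ := h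
  rw [hA.2, hB.2] at htr
  rw [hA.2, hB.1, hB.2] at h1
  rw [hA.2] at h3
  rcases sq_eq_sq_iff_eq_or_eq_neg.mp hsq with hr | hr
  · have hs : B 1 1 = A 1 1 := by omega
    rw [← hr, hs] at h1 h3
    exact ⟨mul_left_cancel₀ hA0 (by linarith), mul_left_cancel₀ hA0 (by linarith)⟩
  · have hr' : B 1 0 = -A 1 0 := by omega
    have hs : B 1 1 = A 1 1 + 3 * A 1 0 := by omega
    rw [hr', hs] at h1 h3
    have e1 : m 0 1 = -3 * m 0 0 - 3 * m 1 0 := mul_left_cancel₀ hA0 (by linarith)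
    have e2 : m 1 1 = -m 0 0 := mul_left_cancel₀ hA0 (by linarith)
    rw [e1, e2] at hdet
    exfalso
    have : (m 0 0 * m 0 0) % 3 = 2 := by
      have : m 0 0 * m 0 0 = 3 * (m 0 0 * m 1 0 + m 1 0 * m 1 0) - 1 := by linarith
      omega
    rcases (by omega : m 0 0 % 3 = 0 ∨ m 0 0 % 3 = 1 ∨ m 0 0 % 3 = 2) with h | h | h <;>
      simp [Int.mul_emod, h] at this

theorem psl_eq_hyperbolic_zpow_of_conj {g : PSL₂ℤ} {p q : ℤ} (hp : p ≠ 0)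
    (h : g * (hyperbolic : PSL₂ℤ) ^ p * g⁻¹ = (hyperbolic : PSL₂ℤ) ^ q) :
    ∃ n : ℤ, g = (hyperbolic : PSL₂ℤ) ^ n := by
  obtain ⟨m, rfl⟩ := QuotientGroup.mk_surjective g
  have hcomm (k : ℤ) : Commute (hyperbolic ^ k) hyperbolic := (Commute.refl _).zpow_left k
  have hm : Commute m hyperbolic := by
    rcases psl_conj_zpow_eq_zpow_iff.mp h with h | h
    · exact commute_hyperbolic_of_conj (hcomm p) (hcomm q) (hyperbolic_zpow_apply_ne_zero hp) h
    · exact commute_hyperbolic_of_conj (hcomm p) (hcomm q).neg_left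
        (hyperbolic_zpow_apply_ne_zero hp) (by rw [h, neg_mul])
  obtain ⟨n, hn⟩ := exists_eq_hyperbolic_zpow hm
  exact ⟨n, psl_mk_eq_zpow_iff.mpr hn⟩

end ConjugationOfPowers

theorem exists_maximal_semidirectProduct {G N P : Type*} [Group G] [Group N] [Group P] [Finite N]
    {f : G →* P} {ι : N →* G} {t : G} {θ : MulAut N} {j : ℕ} (hj : orderOf θ = j)
    (hι : Function.Injective ι) (hker : f.ker = ι.range)
    (hθ : ∀ n, ι (θ n) = t * ι n * t⁻¹) (ht : ∀ n : ℤ, f t ^ n = 1 → n = 0)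
    (hconj : ∀ (g : P) (p q : ℤ), p ≠ 0 → g * f t ^ p * g⁻¹ = f t ^ q → ∃ n : ℤ, g = f t ^ n) :
    ∃ (M : Subgroup G) (φ : Multiplicative ℤ →* MulAut N),
      orderOf (φ (Multiplicative.ofAdd 1)) = j ∧
      Nonempty (M ≃* SemidirectProduct N (Multiplicative ℤ) φ) ∧
      IsVirtuallyCyclic M ∧
      ∀ K : Subgroup G, IsVirtuallyCyclic K → M ≤ K → K = M := by
  have htι (k : ℤ) (hk : t ^ k ∈ ι.range) : k = 0 := by
    rw [← hker, MonoidHom.mem_ker, map_zpow] at hk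
    exact ht k hk
  obtain ⟨M, hM, hMN⟩ := exists_subgroup_mulEquiv_semidirectProduct hι hθ htι
  refine ⟨M, zpowersHom _ θ, by simpa using hj, hMN, isVirtuallyCyclic_of_mem_iff hM, fun K hK hMK => ?_⟩
  have htK : t ∈ K := hMK ((hM t).mpr ⟨1, 1, by simp⟩)
  refine le_antisymm (fun k hk => ?_) hMK
  have htK' (n : ℤ) (hn : (⟨t, htK⟩ : K) ^ n = 1) : n = 0 := by
    have := congrArg (fun g : K => f g) hn
    exact ht n (by simpa using this)
  obtain ⟨p, q, hp, -, hpq⟩ := hK.exists_conj_zpow_eq htK' ⟨k, hk⟩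
  have hpq' := congrArg (fun g : K => f g) hpq
  obtain ⟨n, hn⟩ := hconj (f k) p q hp (by simpa using hpq')
  have hmem : k * (t ^ n)⁻¹ ∈ ι.range := by
    rw [← hker, MonoidHom.mem_ker, map_mul, map_inv, map_zpow, hn, mul_inv_cancel]
  obtain ⟨m, hm⟩ := hmem
  exact (hM k).mpr ⟨m, n, by rw [hm, inv_mul_cancel_right]⟩

section SphereBraidGroup

open MatrixGroups

local notation "PSL₂ℤ" => Matrix.ProjectiveSpecialLinearGroup (Fin 2) ℤ

section Generic

variable {G : Type*} [Group G] {a b c : G}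
  (hac : a * c = c * a) (hab : a * b * a = b * a * b) (hbc : b * c * b = c * b * c)
  (h : a * b * c ^ 2 * b * a = 1) (hgen : Subgroup.closure {a, b, c} = ⊤)

include hac hab hbc h

theorem snd_conj_fst : b * (a * c⁻¹) * b⁻¹ = (b⁻¹ * (a * c⁻¹) * b)⁻¹ := by
  rw [snd_mul hac hab hbc h, mul_inv_cancel_right]

theorem fst_conj_snd : a * (b⁻¹ * (a * c⁻¹) * b) * a⁻¹ =
    b⁻¹ * (a * c⁻¹) * b * (a * c⁻¹)⁻¹ := by
  rw [fst_mul_conj_snd hac hab hbc h, mul_inv_cancel_right]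

omit hab hbc h in
theorem fst_conj_fst : a * (a * c⁻¹) * a⁻¹ = a * c⁻¹ := by
  rw [mul_assoc, mul_assoc, ← mul_inv_rev, hac, mul_inv_rev, mul_inv_cancel_left]

include hgen

theorem normal_closure_pair :
    (Subgroup.closure {a * c⁻¹, b⁻¹ * (a * c⁻¹) * b}).Normal := by
  have hax := fst_conj_fst hac
  have hay := fst_conj_snd hac hab hbc h
  have hbx := snd_conj_fst hac hab hbc h
  have hby : b * (b⁻¹ * (a * c⁻¹) * b) * b⁻¹ = a * c⁻¹ := by group
  have hc : c = (a * c⁻¹)⁻¹ * a := by rw [mul_inv_rev, inv_inv, inv_mul_cancel_right]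
  generalize b⁻¹ * (a * c⁻¹) * b = y at *
  generalize a * c⁻¹ = x at *
  have hx : x ∈ Subgroup.closure {x, y} := Subgroup.subset_closure (by simp)
  have hy : y ∈ Subgroup.closure {x, y} := Subgroup.subset_closure (by simp)
  have ha : a ∈ Subgroup.normalizer (Subgroup.closure {x, y} : Set G) := by
    rw [Subgroup.mem_normalizer_iff_map_conj_eq, MonoidHom.map_closure, Set.image_pair]
    simp only [MonoidHom.coe_coe, MulAut.conj_apply, hax, hay]
    apply le_antisymm <;> rw [Subgroup.closure_le, Set.insert_subset_iff, Set.singleton_subset_iff]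
      <;> constructor
    · exact hx
    · exact mul_mem hy (inv_mem hx)
    · exact Subgroup.subset_closure (by simp)
    · have hx' : x ∈ Subgroup.closure {x, y * x⁻¹} := Subgroup.subset_closure (by simp)
      have hyx : y * x⁻¹ ∈ Subgroup.closure {x, y * x⁻¹} := Subgroup.subset_closure (by simp)
      simpa only [inv_mul_cancel_right, SetLike.mem_coe] using mul_mem hyx hx'
  have hb : b ∈ Subgroup.normalizer (Subgroup.closure {x, y} : Set G) := by
    rw [Subgroup.mem_normalizer_iff_map_conj_eq, MonoidHom.map_closure, Set.image_pair]
    simp only [MonoidHom.coe_coe, MulAut.conj_apply, hbx, hby]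
    apply le_antisymm <;> rw [Subgroup.closure_le, Set.insert_subset_iff, Set.singleton_subset_iff]
      <;> constructor
    · exact inv_mem hy
    · exact hx
    · exact Subgroup.subset_closure (by simp)
    · exact inv_mem_iff.mp (Subgroup.subset_closure (by simp))
  rw [← Subgroup.normalizer_eq_top_iff, eq_top_iff, ← hgen, Subgroup.closure_le]
  rintro _ (rfl | rfl | rfl)
  · exact ha
  · exact hb
  · rw [hc]
    exact mul_mem (inv_mem (Subgroup.le_normalizer hx)) ha

theorem ker_eq_closure_pair {f : G →* PSL₂ℤ} (ha : f a = ModularGroup.T)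
    (hb : f b = (lowerUnipotent⁻¹ : SL(2, ℤ))) (hc : f c = ModularGroup.T) :
    f.ker = Subgroup.closure {a * c⁻¹, b⁻¹ * (a * c⁻¹) * b} := by
  have := normal_closure_pair hac hab hbc h hgen
  set Q := Subgroup.closure {a * c⁻¹, b⁻¹ * (a * c⁻¹) * b} with hQ
  have hx : a * c⁻¹ ∈ Q := Subgroup.subset_closure (by simp)
  have hle : Q ≤ f.ker := by
    rw [hQ, Subgroup.closure_le]
    rintro _ (rfl | rfl) <;> simp [ha, hc]
  refine ((QuotientGroup.injective_lift_iff Q f hle).mp ?_).symm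
  let π := QuotientGroup.mk' Q
  have hπ : π c = π a := by
    have : π (a * c⁻¹) = 1 := (QuotientGroup.eq_one_iff _).mpr hx
    rwa [map_mul, map_inv, mul_inv_eq_one, eq_comm] at this
  refine injective_of_braid_relations (s := π a) (u := π b) ?_ ?_ ?_ ha hb
  · have := MonoidHom.map_closure π {a, b, c}
    rw [hgen, Subgroup.map_top_of_surjective π (QuotientGroup.mk'_surjective Q)] at this
    simpa [Set.image_insert_eq, hπ, Set.insert_comm, Set.pair_comm] using this.symm
  · simpa using congrArg π hab
  · have := congrArg π h
    simp only [map_mul, map_pow, hπ, map_one] at this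
    rw [← this]
    simp [pow_two, mul_assoc]

end Generic

/-- The homomorphism from `B₄(S²)` given by a triple satisfying the defining relations. -/
def sphereBraidHom {G : Type*} [Group G] (a b c : G) (hac : a * c = c * a)
    (hab : a * b * a = b * a * b) (hbc : b * c * b = c * b * c)
    (h : a * b * c ^ 2 * b * a = 1) : B4S2 →* G :=
  PresentedGroup.toGroup (f := ![a, b, c]) <| by
    rintro r (rfl | rfl | rfl | rfl)
    · simpa [mul_inv_eq_one, -mul_inv_rev] using hac
    · simpa [mul_inv_eq_one, -mul_inv_rev] using hab
    · simpa [mul_inv_eq_one, -mul_inv_rev] using hbc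
    · simpa using h

theorem sphereBraidHom_σ {G : Type*} [Group G] {a b c : G} (hac : a * c = c * a)
    (hab : a * b * a = b * a * b) (hbc : b * c * b = c * b * c)
    (h : a * b * c ^ 2 * b * a = 1) (i : Fin 3) :
    sphereBraidHom a b c hac hab hbc h (σ i) = ![a, b, c] i :=
  PresentedGroup.toGroup.of _

theorem σ_zero_mul_σ_two : σ 0 * σ 2 = σ 2 * σ 0 :=
  mul_inv_eq_one.mp (PresentedGroup.one_of_mem (rels := sphereBraidRels) (.inl rfl))

theorem σ_zero_braid : σ 0 * σ 1 * σ 0 = σ 1 * σ 0 * σ 1 :=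
  mul_inv_eq_one.mp (PresentedGroup.one_of_mem (rels := sphereBraidRels) (.inr (.inl rfl)))

theorem σ_one_braid : σ 1 * σ 2 * σ 1 = σ 2 * σ 1 * σ 2 :=
  mul_inv_eq_one.mp (PresentedGroup.one_of_mem (rels := sphereBraidRels) (.inr (.inr (.inl rfl))))

theorem σ_sphere : σ 0 * σ 1 * σ 2 ^ 2 * σ 1 * σ 0 = 1 :=
  PresentedGroup.one_of_mem (rels := sphereBraidRels) (.inr (.inr (.inr rfl)))

theorem closure_σ : Subgroup.closure {σ 0, σ 1, σ 2} = ⊤ := by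
  rw [← PresentedGroup.closure_range_of sphereBraidRels]
  congr 1
  ext g
  simp [Fin.exists_fin_succ, σ, eq_comm]

theorem T_braid : ModularGroup.T * lowerUnipotent⁻¹ * ModularGroup.T =
    lowerUnipotent⁻¹ * ModularGroup.T * lowerUnipotent⁻¹ := by
  ext i j
  fin_cases i <;> fin_cases j <;>
    simp [ModularGroup.coe_T, coe_lowerUnipotent, Matrix.adjugate_fin_two]

theorem T_sphere : ModularGroup.T * lowerUnipotent⁻¹ * ModularGroup.T ^ 2 * lowerUnipotent⁻¹ *
    ModularGroup.T = -1 := by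
  ext i j
  fin_cases i <;> fin_cases j <;>
    simp [ModularGroup.coe_T, coe_lowerUnipotent, Matrix.adjugate_fin_two, pow_two]

/-- The projection `B₄(S²) → PSL₂(ℤ)`. -/
def toPSL : B4S2 →* PSL₂ℤ :=
  sphereBraidHom (ModularGroup.T : PSL₂ℤ) (lowerUnipotent⁻¹ : SL(2, ℤ)) ModularGroup.T rfl
    (congrArg _ T_braid) (congrArg _ T_braid.symm) (psl_mk_eq_mk_iff (B := 1) |>.mpr (.inr T_sphere))

/-- A representation of `B₄(S²)` over the field with seven elements, faithful on `Q₈`. -/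
def toSLSeven : B4S2 →* SL(2, ZMod 7) :=
  sphereBraidHom ⟨!![0, 1; 6, 3], by decide⟩ ⟨!![0, 3; 2, 3], by decide⟩ ⟨!![3, 6; 1, 0], by decide⟩
    (by decide) (by decide) (by decide) (by decide)

theorem sq_σ_zero_mul_inv_σ_two_ne_one : (σ 0 * (σ 2)⁻¹) ^ 2 ≠ 1 := by
  intro h
  have h7 := congrArg toSLSeven h
  have h0 : toSLSeven (σ 0) = ⟨!![0, 1; 6, 3], by decide⟩ := sphereBraidHom_σ _ _ _ _ 0
  have h2 : toSLSeven (σ 2) = ⟨!![3, 6; 1, 0], by decide⟩ := sphereBraidHom_σ _ _ _ _ 2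
  rw [map_pow, map_mul, map_inv, map_one, h0, h2] at h7
  revert h7
  decide

/-- The embedding of `Q₈` in `B₄(S²)`. -/
def quaternionToB4S2 : QuaternionGroup 2 →* B4S2 :=
  quaternionHom (σ 0 * (σ 2)⁻¹) ((σ 1)⁻¹ * (σ 0 * (σ 2)⁻¹) * σ 1)
    (pow_four_eq_one σ_zero_mul_σ_two σ_zero_braid σ_one_braid σ_sphere)
    (sq_eq_conj_snd_sq σ_zero_mul_σ_two σ_zero_braid σ_one_braid σ_sphere)
    (conj_snd_mul σ_zero_mul_σ_two σ_zero_braid σ_one_braid σ_sphere)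

theorem quaternionToB4S2_injective : Function.Injective quaternionToB4S2 :=
  quaternionHom_injective _ _ _ sq_σ_zero_mul_inv_σ_two_ne_one

theorem toPSL_σ_zero : toPSL (σ 0) = ModularGroup.T := sphereBraidHom_σ _ _ _ _ 0

theorem toPSL_σ_one : toPSL (σ 1) = (lowerUnipotent⁻¹ : SL(2, ℤ)) := sphereBraidHom_σ _ _ _ _ 1

theorem toPSL_σ_two : toPSL (σ 2) = ModularGroup.T := sphereBraidHom_σ _ _ _ _ 2

theorem ker_toPSL : toPSL.ker = quaternionToB4S2.range := by
  rw [quaternionToB4S2, range_quaternionHom]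
  exact ker_eq_closure_pair σ_zero_mul_σ_two σ_zero_braid σ_one_braid σ_sphere closure_σ
    toPSL_σ_zero toPSL_σ_one toPSL_σ_two

theorem quaternionToB4S2_orderTwoAut (g : QuaternionGroup 2) :
    quaternionToB4S2 (orderTwoAut g) =
      σ 0 * ((σ 1)⁻¹ * (σ 0 * (σ 2)⁻¹) * σ 1) * quaternionToB4S2 g *
        (σ 0 * ((σ 1)⁻¹ * (σ 0 * (σ 2)⁻¹) * σ 1))⁻¹ := by
  have hx := fst_conj_fst σ_zero_mul_σ_two
  have hy := fst_conj_snd σ_zero_mul_σ_two σ_zero_braid σ_one_braid σ_sphere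
  have hyx := conj_snd_mul σ_zero_mul_σ_two σ_zero_braid σ_one_braid σ_sphere
  have hx4 := pow_four_eq_one σ_zero_mul_σ_two σ_zero_braid σ_one_braid σ_sphere
  refine map_mulAut_eq_conj ?_ ?_ g
  · change (σ 0 * (σ 2)⁻¹) ^ 3 = _ * (σ 0 * (σ 2)⁻¹) ^ 1 * _
    generalize (σ 1)⁻¹ * (σ 0 * (σ 2)⁻¹) * σ 1 = y at *
    generalize σ 0 * (σ 2)⁻¹ = x at *
    have hx3 : x ^ 3 = x⁻¹ := eq_inv_of_mul_eq_one_left (by rw [← pow_succ, hx4])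
    calc x ^ 3 = (σ 0 * x * (σ 0)⁻¹)⁻¹ := by rw [hx3, hx]
      _ = σ 0 * (x⁻¹ * y) * y⁻¹ * (σ 0)⁻¹ := by group
      _ = σ 0 * y * x ^ 1 * (σ 0 * y)⁻¹ := by rw [← hyx]; group
  · change (σ 1)⁻¹ * (σ 0 * (σ 2)⁻¹) * σ 1 * (σ 0 * (σ 2)⁻¹) ^ 3 =
      _ * ((σ 1)⁻¹ * (σ 0 * (σ 2)⁻¹) * σ 1 * (σ 0 * (σ 2)⁻¹) ^ 0) * _
    generalize (σ 1)⁻¹ * (σ 0 * (σ 2)⁻¹) * σ 1 = y at *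
    generalize σ 0 * (σ 2)⁻¹ = x at *
    have hx3 : x ^ 3 = x⁻¹ := eq_inv_of_mul_eq_one_left (by rw [← pow_succ, hx4])
    rw [hx3, ← hy]
    group

theorem quaternionToB4S2_orderThreeAut (g : QuaternionGroup 2) :
    quaternionToB4S2 (orderThreeAut g) =
      σ 0 ^ 3 * (σ 1)⁻¹ * quaternionToB4S2 g * (σ 0 ^ 3 * (σ 1)⁻¹)⁻¹ := by
  have hx := fst_conj_fst σ_zero_mul_σ_two
  have hy := fst_conj_snd σ_zero_mul_σ_two σ_zero_braid σ_one_braid σ_sphere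
  have hbx := snd_conj_fst σ_zero_mul_σ_two σ_zero_braid σ_one_braid σ_sphere
  have hx4 := pow_four_eq_one σ_zero_mul_σ_two σ_zero_braid σ_one_braid σ_sphere
  refine map_mulAut_eq_conj ?_ ?_ g
  · change (σ 1)⁻¹ * (σ 0 * (σ 2)⁻¹) * σ 1 * (σ 0 * (σ 2)⁻¹) ^ 1 =
      _ * (σ 0 * (σ 2)⁻¹) ^ 1 * _
    generalize h : (σ 1)⁻¹ * (σ 0 * (σ 2)⁻¹) * σ 1 = y at *
    generalize σ 0 * (σ 2)⁻¹ = x at *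
    generalize σ 0 = a at *
    generalize σ 1 = b at *
    have hax : MulAut.conj a x = x := hx
    have hay : MulAut.conj a y = y * x⁻¹ := hy
    have hy3 : MulAut.conj (a ^ 3) y = y * x⁻¹ * x⁻¹ * x⁻¹ := by
      simp only [pow_succ, pow_zero, one_mul, MulAut.mul_apply, hay, map_mul, map_inv, hax]
    calc y * x ^ 1 = y * x⁻¹ * x⁻¹ * x⁻¹ * x ^ 4 := by group
      _ = a ^ 3 * y * (a ^ 3)⁻¹ := by rw [hx4, ← hy3, mul_one, MulAut.conj_apply]
      _ = a ^ 3 * b⁻¹ * x ^ 1 * (a ^ 3 * b⁻¹)⁻¹ := by rw [← h]; simp [mul_assoc]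
  · change (σ 0 * (σ 2)⁻¹) ^ 3 =
      _ * ((σ 1)⁻¹ * (σ 0 * (σ 2)⁻¹) * σ 1 * (σ 0 * (σ 2)⁻¹) ^ 0) * _
    generalize (σ 1)⁻¹ * (σ 0 * (σ 2)⁻¹) * σ 1 = y at *
    generalize σ 0 * (σ 2)⁻¹ = x at *
    generalize σ 0 = a at *
    generalize σ 1 = b at *
    have hx3 : x ^ 3 = x⁻¹ := eq_inv_of_mul_eq_one_left (by rw [← pow_succ, hx4])
    have hax : Commute a x := mul_inv_eq_iff_eq_mul.mp hx
    calc x ^ 3 = (a ^ 3 * x * (a ^ 3)⁻¹)⁻¹ := by rw [hx3, (hax.pow_left 3).eq, mul_inv_cancel_right]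
      _ = a ^ 3 * b⁻¹ * (b * x * b⁻¹)⁻¹ * (a ^ 3 * b⁻¹)⁻¹ := by group
      _ = a ^ 3 * b⁻¹ * (y * x ^ 0) * (a ^ 3 * b⁻¹)⁻¹ := by rw [hbx]; group

end SphereBraidGroup

/-- For each `j ∈ {2, 3}`, there is a subgroup of `B₄(S²)` isomorphic to
a semidirect product `Q₈ ⋊ ℤ` in which the generator of `ℤ` acts by an automorphism of
order `j`, that is maximal as a virtually cyclic subgroup of `B₄(S²)`. -/
theorem maximal_Q8_semidirect_Z_subgroups (j : ℕ) (hj : j ∈ ({2, 3} : Set ℕ)) :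
    ∃ (M : Subgroup B4S2) (φ : Multiplicative ℤ →* MulAut (QuaternionGroup 2)),
      orderOf (φ (Multiplicative.ofAdd 1)) = j ∧
      Nonempty (M ≃* SemidirectProduct (QuaternionGroup 2) (Multiplicative ℤ) φ) ∧
      IsVirtuallyCyclic M ∧
      ∀ K : Subgroup B4S2, IsVirtuallyCyclic K → M ≤ K → K = M := by
  rcases hj with rfl | rfl
  · have ht : toPSL (σ 0 * ((σ 1)⁻¹ * (σ 0 * (σ 2)⁻¹) * σ 1)) = ModularGroup.T := by
      simp [toPSL_σ_zero, toPSL_σ_two]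
    refine exists_maximal_semidirectProduct orderOf_orderTwoAut quaternionToB4S2_injective
      ker_toPSL quaternionToB4S2_orderTwoAut ?_ ?_ <;> rw [ht]
    exacts [fun _ => psl_T_zpow_eq_one, fun _ _ _ => psl_eq_T_zpow_of_conj]
  · have ht : toPSL (σ 0 ^ 3 * (σ 1)⁻¹) = hyperbolic := by
      rw [map_mul, map_pow, map_inv, toPSL_σ_zero, toPSL_σ_one, ← T_pow_three_mul_lowerUnipotent,
        QuotientGroup.mk_inv, inv_inv]
      rfl
    refine exists_maximal_semidirectProduct orderOf_orderThreeAut quaternionToB4S2_injective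
      ker_toPSL quaternionToB4S2_orderThreeAut ?_ ?_ <;> rw [ht]
    exacts [fun _ => psl_hyperbolic_zpow_eq_one, fun _ _ _ => psl_eq_hyperbolic_zpow_of_conj]
end

section
/- Let m be an odd prime and let G = QuaternionGroup m be the dicyclic group of order 4m. On the set of elements of G of order m, consider the equivalence relation f ∼ g ⇔ there exists k : ℕ with f^(2^k) conjugate to g in G, and let λ be the number of equivalence classes. Let e be the multiplicative order of (2 : (ZMod m)ˣ), and let ⟨2⟩ be the subgroup of (ZMod m)ˣ generated by 2. Then λ = (m−1)/e if −1 ∈ ⟨2⟩, and λ = (m−1)/(2e) if −1 ∉ ⟨2⟩. -/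
namespace QuaternionGroup

theorem a_pow {n : ℕ} (i : ZMod (2 * n)) (k : ℕ) : a i ^ k = a ((k : ZMod (2 * n)) * i) := by
  induction k with
  | zero => simp
  | succ k ih => rw [pow_succ, ih, a_mul_a]; congr 1; push_cast; ring

theorem isConj_a_iff {n : ℕ} (i j : ZMod (2 * n)) :
    IsConj (a i) (a j) ↔ j = i ∨ j = -i := by
  rw [isConj_iff]
  constructor
  · rintro ⟨c | c, h⟩ <;> rw [mul_inv_eq_iff_eq_mul] at h
    · simp only [a_mul_a, a.injEq] at h
      left; linear_combination -h
    · simp only [xa_mul_a, a_mul_xa, xa.injEq] at h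
      right; linear_combination h
  · rintro (rfl | rfl)
    · exact ⟨1, by simp⟩
    · refine ⟨xa 0, ?_⟩
      rw [mul_inv_eq_iff_eq_mul]
      simp

/-- The element of `QuaternionGroup m` of order `m` with a given nonzero residue mod `m`. -/
def ofUnit {m : ℕ} (hodd : Odd m) (w : (ZMod m)ˣ) : QuaternionGroup m :=
  a ((ZMod.chineseRemainder hodd.coprime_two_left).symm (0, (w : ZMod m)))

theorem ofUnit_injective {m : ℕ} (hodd : Odd m) : Function.Injective (ofUnit hodd) := by
  intro v w h
  simp only [ofUnit, a.injEq, EmbeddingLike.apply_eq_iff_eq, Prod.mk.injEq, true_and] at h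
  exact Units.ext h

theorem isConj_ofUnit_pow_iff {m : ℕ} (hodd : Odd m) (v w : (ZMod m)ˣ) (k : ℕ) :
    IsConj (ofUnit hodd v ^ k) (ofUnit hodd w) ↔
      (w : ZMod m) = k * v ∨ (w : ZMod m) = -(k * v) := by
  rw [ofUnit, ofUnit, a_pow, isConj_a_iff]
  simp only [RingEquiv.symm_apply_eq, map_mul, map_neg, RingEquiv.apply_symm_apply, map_natCast,
    Prod.ext_iff, Prod.fst_mul, Prod.snd_mul, Prod.fst_neg, Prod.snd_neg, Prod.snd_natCast,
    mul_zero, neg_zero, true_and]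

theorem orderOf_ofUnit {m : ℕ} (hm : m.Prime) (hodd : Odd m) (w : (ZMod m)ˣ) :
    orderOf (ofUnit hodd w) = m := by
  have := Fact.mk hm
  apply orderOf_eq_prime
  · rw [ofUnit, a_pow, one_def, a.injEq, ← map_natCast (ZMod.chineseRemainder
      hodd.coprime_two_left).symm, ← map_mul, map_eq_zero_iff _ (RingEquiv.injective _)]
    simp [Prod.ext_iff]
  · rw [ofUnit, one_def, ne_eq, a.injEq, map_eq_zero_iff _ (RingEquiv.injective _)]
    simp [Prod.ext_iff]

theorem exists_ofUnit_eq {m : ℕ} (hm : m.Prime) (hodd : Odd m) {g : QuaternionGroup m}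
    (hg : orderOf g = m) : ∃ w, ofUnit hodd w = g := by
  have := Fact.mk hm
  rcases g with i | i
  · obtain ⟨⟨b, c⟩, rfl⟩ := (ZMod.chineseRemainder hodd.coprime_two_left).symm.surjective i
    have hpow := pow_orderOf_eq_one (a ((ZMod.chineseRemainder
      hodd.coprime_two_left).symm (b, c)))
    rw [hg, a_pow, one_def, a.injEq, ← map_natCast (ZMod.chineseRemainder
      hodd.coprime_two_left).symm, ← map_mul, map_eq_zero_iff _ (RingEquiv.injective _)] at hpow
    have hm2 : (m : ZMod 2) = 1 := (ZMod.natCast_eq_one_iff_odd).2 hodd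
    have hb : b = 0 := by simpa [Prod.ext_iff, hm2] using hpow
    subst hb
    have hc : c ≠ 0 := by
      rintro rfl
      rw [← Prod.zero_eq_mk, map_zero, a_zero, orderOf_one] at hg
      exact hm.one_lt.ne hg
    exact ⟨Units.mk0 c hc, rfl⟩
  · rw [orderOf_xa] at hg
    subst hg
    exact absurd hodd (by decide)

/-- Nonzero residues mod an odd prime `m` parametrize the elements of order `m` of
`QuaternionGroup m`. -/
noncomputable def unitsEquiv {m : ℕ} (hm : m.Prime) (hodd : Odd m) :
    (ZMod m)ˣ ≃ {g : QuaternionGroup m // orderOf g = m} :=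
  Equiv.ofBijective (fun w => ⟨ofUnit hodd w, orderOf_ofUnit hm hodd w⟩)
    ⟨fun _ _ h => ofUnit_injective hodd (congrArg Subtype.val h),
      fun g => (exists_ofUnit_eq hm hodd g.2).imp fun _ h => Subtype.ext h⟩

theorem card_quot_isConj_two_pow {m : ℕ} (hm : m.Prime) (hodd : Odd m)
    {u : (ZMod m)ˣ} (hu : (u : ZMod m) = 2) (H : Subgroup (ZMod m)ˣ)
    (hH : ∀ x, x ∈ H ↔ ∃ k : ℕ, x = u ^ k ∨ x = -u ^ k) :
    Nat.card (Quot (fun f g : {g : QuaternionGroup m // orderOf g = m} =>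
      ∃ k : ℕ, IsConj (f.1 ^ 2 ^ k) g.1)) = (m - 1) / Nat.card H := by
  have := Fact.mk hm
  have hquot : Nat.card ((ZMod m)ˣ ⧸ H) = Nat.card (Quot
      (fun f g : {g : QuaternionGroup m // orderOf g = m} =>
        ∃ k : ℕ, IsConj (f.1 ^ 2 ^ k) g.1)) := by
    refine Nat.card_congr (Quot.congr (unitsEquiv hm hodd) fun v w => ?_)
    change QuotientGroup.leftRel H v w ↔
      ∃ k : ℕ, IsConj (ofUnit hodd v ^ 2 ^ k) (ofUnit hodd w)
    rw [QuotientGroup.leftRel_apply, hH]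
    refine exists_congr fun k => ?_
    rw [isConj_ofUnit_pow_iff, inv_mul_eq_iff_eq_mul, inv_mul_eq_iff_eq_mul, Units.ext_iff,
      Units.ext_iff]
    push_cast
    rw [hu, mul_neg, mul_comm]
  have hcard := H.card_eq_card_quotient_mul_card_subgroup
  rw [Nat.card_eq_fintype_card, ZMod.card_units] at hcard
  rw [← hquot, hcard, Nat.mul_div_cancel _ Nat.card_pos]

end QuaternionGroup

theorem ZMod.odd_orderOf_of_neg_one_notMem_zpowers {m : ℕ} (hm : m.Prime) {u : (ZMod m)ˣ}
    (h : -1 ∉ Subgroup.zpowers u) : Odd (orderOf u) := by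
  have := Fact.mk hm
  by_contra heven
  obtain ⟨k, hk⟩ := even_iff_two_dvd.1 (Nat.not_odd_iff_even.1 heven)
  have hpos := orderOf_pos u
  have hsq : (u ^ k) ^ 2 = 1 := by rw [← pow_mul, mul_comm, ← hk, pow_orderOf_eq_one]
  have hval : ((u ^ k : (ZMod m)ˣ) : ZMod m) ^ 2 = 1 := by
    simpa using congrArg Units.val hsq
  rcases mul_self_eq_one_iff.1 ((sq _).symm.trans hval) with h1 | h1
  · have hk0 : k ≠ 0 := by omega
    have hlt : k < orderOf u := by omega
    exact pow_ne_one_of_lt_orderOf hk0 hlt (Units.ext (by simpa using h1))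
  · exact h ⟨(k : ℤ), Units.ext (by simpa using h1)⟩


/-- Let `m` be an odd prime and let `G = QuaternionGroup m` be the
dicyclic group of order `4m`.  Let `λ` be the number of equivalence classes of elements of
`G` of order `m` under the relation `f ∼ g ↔ ∃ k, f^(2^k)` is conjugate to `g` (the
`ℚ₂`-conjugacy relation).  If `u` is the unit `2` of `ZMod m` and `e` its multiplicative
order, then `λ = (m-1)/e` if `-1 ∈ ⟨2⟩`, and `λ = (m-1)/(2e)` otherwise. -/
theorem q2_conjugacy_class_count_dicyclic (m : ℕ) (hm : m.Prime) (hodd : Odd m)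
    (u : (ZMod m)ˣ) (hu : (u : ZMod m) = 2) :
    (((-1 : (ZMod m)ˣ) ∈ Subgroup.zpowers u →
        Nat.card (Quot (fun f g : {g : QuaternionGroup m // orderOf g = m} =>
          ∃ k : ℕ, IsConj (f.1 ^ 2 ^ k) g.1)) = (m - 1) / orderOf u) ∧
      ((-1 : (ZMod m)ˣ) ∉ Subgroup.zpowers u →
        Nat.card (Quot (fun f g : {g : QuaternionGroup m // orderOf g = m} =>
          ∃ k : ℕ, IsConj (f.1 ^ 2 ^ k) g.1)) = (m - 1) / (2 * orderOf u))) := by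
  have := Fact.mk hm
  constructor
  · intro h
    rw [QuaternionGroup.card_quot_isConj_two_pow hm hodd hu (Subgroup.zpowers u), Nat.card_zpowers]
    intro x
    constructor
    · intro hx
      obtain ⟨k, hk⟩ := mem_powers_iff_mem_zpowers.2 hx
      exact ⟨k, Or.inl hk.symm⟩
    · rintro ⟨k, rfl | rfl⟩
      · exact Subgroup.npow_mem_zpowers u k
      · rw [← neg_one_mul]
        exact mul_mem h (Subgroup.npow_mem_zpowers u k)
  · intro h
    have he := ZMod.odd_orderOf_of_neg_one_notMem_zpowers hm h
    have hneg : orderOf (-1 : (ZMod m)ˣ) = 2 := by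
      refine orderOf_eq_prime (by simp) fun h1 => h ?_
      rw [h1]
      exact one_mem _
    have hord : orderOf (-u) = 2 * orderOf u := by
      rw [← neg_one_mul, (Commute.all _ _).orderOf_mul_eq_mul_orderOf_of_coprime, hneg]
      rw [hneg]
      exact he.coprime_two_left
    have hmem : (-1 : (ZMod m)ˣ) ∈ Subgroup.zpowers (-u) := by
      refine ⟨orderOf u, ?_⟩
      simp [he.neg_pow, pow_orderOf_eq_one]
    have hu_mem : u ∈ Subgroup.zpowers (-u) := by
      simpa using mul_mem hmem (Subgroup.mem_zpowers (-u))
    rw [QuaternionGroup.card_quot_isConj_two_pow hm hodd hu (Subgroup.zpowers (-u)),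
      Nat.card_zpowers, hord]
    intro x
    constructor
    · intro hx
      obtain ⟨k, rfl⟩ := mem_powers_iff_mem_zpowers.2 hx
      exact ⟨k, (Nat.even_or_odd k).imp (fun hk => hk.neg_pow u) fun hk => hk.neg_pow u⟩
    · rintro ⟨k, rfl | rfl⟩
      · exact pow_mem hu_mem k
      · simpa using mul_mem hmem (pow_mem hu_mem k)
end
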